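/- arXiv:2303.09265 — 2 statements merged into one kernel-verified Lean document; each statement's English description precedes it below -/
import Mathlib

section
/- Let q ≥ 3 be a power of an odd prime, c ∈ F_q*, and let k be an integer with k > 4. Then for every υ ∈ F_q and every ω ∈ F_q*, there exists ξ ∈ F_{q^k}* such that Tr(ξ + c·ξ^{−1}) + υ = 0 and ω·N(ξ) = 1. -/
section Stepanov

open Polynomial

theorem exists_ne_zero_sum_smul_eq_zero {F ι κ : Type*} [Field F] [Fintype ι] [Fintype κ]
    (N : ℕ) (B : ι → κ → F[X]) (hB : ∀ i k, (B i k).degree < N)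
    (hcard : Fintype.card κ * N < Fintype.card ι) :
    ∃ a : ι → F, a ≠ 0 ∧ ∀ k, ∑ i, a i • B i k = 0 := by
  let f : (ι → F) →ₗ[F] (κ → Fin N → F) :=
    { toFun := fun a k j => ∑ i, a i * (B i k).coeff j
      map_add' := fun a b => by
        ext k j; simp [add_mul, Finset.sum_add_distrib]
      map_smul' := fun r a => by
        ext k j; simp [Finset.mul_sum, mul_assoc] }
  have hker : LinearMap.ker f ≠ ⊥ := f.ker_ne_bot_of_finrank_lt <| by
    simpa [Module.finrank_pi_fintype] using hcard
  obtain ⟨a, ha, hane⟩ := (Submodule.ne_bot_iff _).1 hker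
  refine ⟨a, hane, fun k => ?_⟩
  ext j
  by_cases hj : j < N
  · simpa [f, finsetSum_coeff] using congr_fun (congr_fun (LinearMap.mem_ker.1 ha) k) ⟨j, hj⟩
  · rw [finsetSum_coeff, coeff_zero]
    refine Finset.sum_eq_zero fun i _ => ?_
    rw [coeff_smul, coeff_eq_zero_of_degree_lt ((hB i k).trans_le (by exact_mod_cast not_lt.1 hj)),
      smul_zero]

theorem sum_smul_ne_zero_of_injective_natDegree {F ι : Type*} [Field F] [Fintype ι]
    (m : ι → F[X]) (hm : ∀ i, m i ≠ 0) (hinj : Function.Injective fun i => (m i).natDegree)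
    (a : ι → F) (ha : a ≠ 0) : ∑ i, a i • m i ≠ 0 := by
  obtain ⟨i, hi⟩ := Function.ne_iff.1 ha
  have h := degree_sum_eq_of_disjoint (fun i => a i • m i) Finset.univ (by
    rintro i ⟨-, hi⟩ j ⟨-, hj⟩ hij h
    have hai : a i ≠ 0 := by rintro h; simp [h] at hi
    have haj : a j ≠ 0 := by rintro h; simp [h] at hj
    refine hij (hinj ?_)
    have := natDegree_eq_of_degree_eq h
    simpa [natDegree_smul, hai, haj] using this)
  intro h0
  rw [h0, degree_zero, eq_comm, Finset.sup_eq_bot_iff] at h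
  have := h i (Finset.mem_univ i)
  rw [degree_eq_bot, smul_eq_zero] at this
  exact this.elim hi (hm i)

theorem X_sub_C_pow_dvd_of_X_pow_dvd_aeval {F : Type*} [Field F] {ξ : F} (hξ : ξ ≠ 0) (k : ℕ)
    (G : F[X])
    (h : (PowerSeries.X : PowerSeries F) ^ k ∣
      aeval (PowerSeries.C ξ * (1 + PowerSeries.X)) G) :
    (X - C ξ) ^ k ∣ G := by
  have h1 : aeval (PowerSeries.C ξ * (1 + PowerSeries.X)) G =
      ((G.comp (C ξ * (1 + X)) : F[X]) : PowerSeries F) := by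
    have := (aeval_algHom_apply (coeToPowerSeries.algHom (R := F) F) (C ξ * (1 + X)) G)
    simp only [coeToPowerSeries.algHom_apply, Algebra.algebraMap_self, PowerSeries.map_id] at this
    simpa [comp_eq_aeval] using this
  have h2 : (X : F[X]) ^ k ∣ G.comp (C ξ * (1 + X)) := by
    rw [X_pow_dvd_iff]
    rw [h1, PowerSeries.X_pow_dvd_iff] at h
    simpa using h
  have h3 := map_dvd (compRingHom (C ξ⁻¹ * X - 1)) h2
  simp only [coe_compRingHom_apply, comp_assoc, X_pow_comp] at h3
  have h4 : (C ξ * (1 + X)).comp (C ξ⁻¹ * X - 1) = (X : F[X]) := by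
    simp [← mul_assoc, ← C_mul, hξ]
  rw [h4, comp_X] at h3
  have h5 : (C ξ⁻¹ * X - 1 : F[X]) = C ξ⁻¹ * (X - C ξ) := by
    simp [mul_sub, ← C_mul, hξ]
  rw [h5, mul_pow] at h3
  exact (Dvd.intro_left _ rfl).trans h3

theorem card_mul_le_natDegree {F : Type*} [Field F] (S : Finset F) (k : ℕ) {G : F[X]}
    (hG : G ≠ 0) (h : ∀ ξ ∈ S, (X - C ξ) ^ k ∣ G) : S.card * k ≤ G.natDegree := by
  have h1 : ∏ ξ ∈ S, (X - C ξ) ^ k ∣ G := by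
    refine Finset.prod_dvd_of_coprime (fun a _ b _ hab => ?_) h
    exact (isCoprime_X_sub_C_of_isUnit_sub (sub_ne_zero.2 hab).isUnit).pow
  have h2 := natDegree_le_of_dvd h1 hG
  rw [natDegree_prod_of_monic _ _ (fun ξ _ => (monic_X_sub_C ξ).pow k)] at h2
  simpa using h2

/-- The auxiliary polynomial argument: if the local expansions of the `m i` at the points `ξ` of `S`
have, up to a common factor, coefficients that are interpolated by polynomials in `ξ` of
degree less than `N`, then a nontrivial combination of the `m i` vanishes to order `k` on `S`. -/
theorem card_mul_le_of_local_expansions {F ι : Type*} [Field F] [Fintype ι] (S : Finset F)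
    (hS : ∀ ξ ∈ S, ξ ≠ 0) (k N Δ : ℕ) (m : ι → F[X]) (hm : ∀ i, m i ≠ 0)
    (hinj : Function.Injective fun i => (m i).natDegree) (hdeg : ∀ i, (m i).natDegree ≤ Δ)
    (U : F → PowerSeries F) (f : ι → F → PowerSeries F)
    (hf : ∀ i, ∀ ξ ∈ S, aeval (PowerSeries.C ξ * (1 + PowerSeries.X)) (m i) = U ξ * f i ξ)
    (hB : ∀ i, ∀ r < k, ∃ B : F[X], B.degree < N ∧
      ∀ ξ ∈ S, ξ ^ r * PowerSeries.coeff r (f i ξ) = B.eval ξ)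
    (hcard : k * N < Fintype.card ι) : S.card * k ≤ Δ := by
  choose B hBdeg hBeval using fun i (r : Fin k) => hB i r r.2
  obtain ⟨a, ha, hab⟩ := exists_ne_zero_sum_smul_eq_zero N B hBdeg (by simpa using hcard)
  refine (card_mul_le_natDegree S k (sum_smul_ne_zero_of_injective_natDegree m hm hinj a ha)
    fun ξ hξ => X_sub_C_pow_dvd_of_X_pow_dvd_aeval (hS ξ hξ) k _ ?_).trans
    (natDegree_sum_le_of_forall_le _ _ fun i _ => (natDegree_smul_le _ _).trans (hdeg i))
  have h1 : aeval (PowerSeries.C ξ * (1 + PowerSeries.X)) (∑ i, a i • m i) =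
      U ξ * ∑ i, a i • f i ξ := by
    simp [map_sum, map_smul, hf _ ξ hξ, Finset.mul_sum]
  rw [h1]
  refine Dvd.dvd.mul_left (PowerSeries.X_pow_dvd_iff.2 fun r hr => ?_) _
  refine mul_left_cancel₀ (pow_ne_zero r (hS ξ hξ)) ?_
  have h2 := congr_arg (eval ξ) (hab ⟨r, hr⟩)
  simp only [eval_finsetSum, eval_smul, ← hBeval _ ⟨r, hr⟩ ξ hξ, smul_eq_mul, eval_zero] at h2
  rw [mul_zero, ← h2, map_sum, Finset.mul_sum]
  refine Finset.sum_congr rfl fun i _ => ?_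
  rw [map_smul, smul_eq_mul]
  ring

end Stepanov

section LowDegreeCoeffs

open PowerSeries

variable {F : Type*} [Field F] {S : Set F}

/-- After scaling by `ξ ^ r`, the `r`-th coefficient of `f ξ` is given on `S` by a polynomial in `ξ`
of degree at most `2 * r`. -/
def HasLowDegreeCoeffs (S : Set F) (f : F → PowerSeries F) : Prop :=
  ∀ r, ∃ B : Polynomial F, B.natDegree ≤ 2 * r ∧ ∀ ξ ∈ S, ξ ^ r * coeff r (f ξ) = B.eval ξ

theorem HasLowDegreeCoeffs.const (g : PowerSeries F) : HasLowDegreeCoeffs S fun _ => g := fun r =>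
  ⟨Polynomial.C (coeff r g) * Polynomial.X ^ r,
    (Polynomial.natDegree_C_mul_X_pow_le _ _).trans (by lia), fun ξ _ => by
      simp [mul_comm (ξ ^ r)]⟩

theorem HasLowDegreeCoeffs.add {f g : F → PowerSeries F} (hf : HasLowDegreeCoeffs S f)
    (hg : HasLowDegreeCoeffs S g) : HasLowDegreeCoeffs S fun ξ => f ξ + g ξ := fun r => by
  obtain ⟨A, hA, hA'⟩ := hf r
  obtain ⟨B, hB, hB'⟩ := hg r
  exact ⟨A + B, Polynomial.natDegree_add_le_of_degree_le hA hB, fun ξ hξ => by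
    rw [map_add, mul_add, hA' ξ hξ, hB' ξ hξ, Polynomial.eval_add]⟩

theorem HasLowDegreeCoeffs.mul {f g : F → PowerSeries F} (hf : HasLowDegreeCoeffs S f)
    (hg : HasLowDegreeCoeffs S g) : HasLowDegreeCoeffs S fun ξ => f ξ * g ξ := fun r => by
  choose A hA hA' using hf
  choose B hB hB' using hg
  refine ⟨∑ x ∈ Finset.HasAntidiagonal.antidiagonal r, A x.1 * B x.2,
    Polynomial.natDegree_sum_le_of_forall_le _ _ fun x hx => ?_, fun ξ hξ => ?_⟩
  · have := hA x.1
    have := hB x.2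
    have := Finset.HasAntidiagonal.mem_antidiagonal.1 hx
    exact Polynomial.natDegree_mul_le.trans (by lia)
  · rw [coeff_mul, Finset.mul_sum, Polynomial.eval_finsetSum]
    refine Finset.sum_congr rfl fun x hx => ?_
    rw [Polynomial.eval_mul, ← hA' _ ξ hξ, ← hB' _ ξ hξ,
      ← Finset.HasAntidiagonal.mem_antidiagonal.1 hx, pow_add]
    ring

theorem HasLowDegreeCoeffs.pow {f : F → PowerSeries F} (hf : HasLowDegreeCoeffs S f) (n : ℕ) :
    HasLowDegreeCoeffs S fun ξ => f ξ ^ n := by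
  induction n with
  | zero => simpa using HasLowDegreeCoeffs.const 1
  | succ n ih => simpa only [pow_succ] using ih.mul hf

theorem HasLowDegreeCoeffs.sum {ι : Type*} (s : Finset ι) {f : ι → F → PowerSeries F}
    (hf : ∀ i ∈ s, HasLowDegreeCoeffs S (f i)) :
    HasLowDegreeCoeffs S fun ξ => ∑ i ∈ s, f i ξ := by
  classical
  induction s using Finset.induction_on with
  | empty => simpa using HasLowDegreeCoeffs.const 0
  | insert i s hi ih =>
    simp only [Finset.sum_insert hi]
    exact (hf i (Finset.mem_insert_self i s)).add
      (ih fun j hj => hf j (Finset.mem_insert_of_mem hj))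

theorem hasLowDegreeCoeffs_C_pow_mul_X_pow (a : ℕ) :
    HasLowDegreeCoeffs S fun ξ => C (ξ ^ a) * X ^ a := fun r => by
  rcases eq_or_ne r a with rfl | h
  · refine ⟨Polynomial.X ^ (2 * r), (Polynomial.natDegree_X_pow_le _), fun ξ _ => ?_⟩
    rw [coeff_C_mul, coeff_X_pow_self]
    simp [two_mul, pow_add]
  · exact ⟨0, by simp, fun ξ _ => by rw [coeff_C_mul, coeff_X_pow]; simp [h]⟩

theorem hasLowDegreeCoeffs_C_inv_pow_mul (hS : (0 : F) ∉ S) (a : ℕ) {g : PowerSeries F}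
    (hg : X ^ a ∣ g) : HasLowDegreeCoeffs S fun ξ => C (ξ⁻¹ ^ a) * g := fun r => by
  rcases lt_or_ge r a with h | h
  · exact ⟨0, by simp, fun ξ _ => by simp [X_pow_dvd_iff.1 hg r h]⟩
  · refine ⟨Polynomial.C (coeff r g) * Polynomial.X ^ (r - a),
      (Polynomial.natDegree_C_mul_X_pow_le _ _).trans (by lia), fun ξ hξ => ?_⟩
    have h0 : ξ ≠ 0 := fun h => hS (h ▸ hξ)
    simp only [coeff_C_mul, inv_pow, Polynomial.eval_mul, Polynomial.eval_C, Polynomial.eval_pow,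
      Polynomial.eval_X]
    rw [pow_sub₀ _ h0 h]
    ring

end LowDegreeCoeffs

section StepanovPolynomials

open Polynomial

/-- The trace of `x + c * x⁻¹`, multiplied by `x ^ q ^ (n - 1)` to clear denominators. -/
noncomputable def traceNumerator {F : Type*} [Field F] (c : F) (q n : ℕ) : F[X] :=
  ∑ l ∈ Finset.range n, (X ^ (q ^ (n - 1) + q ^ l) + C c * X ^ (q ^ (n - 1) - q ^ l))

theorem traceNumerator_monic_and_natDegree {F : Type*} [Field F] (c : F) {q n : ℕ} (hq : 1 < q)
    (hn : n ≠ 0) :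
    (traceNumerator c q n).Monic ∧ (traceNumerator c q n).natDegree = 2 * q ^ (n - 1) := by
  obtain ⟨n, rfl⟩ := Nat.exists_eq_succ_of_ne_zero hn
  have hlow : (∑ l ∈ Finset.range n, (X ^ (q ^ n + q ^ l) + C c * X ^ (q ^ n - q ^ l)) +
      C c : F[X]).degree < (2 * q ^ n : ℕ) := by
    have hpos : 0 < q ^ n := by positivity
    refine (degree_add_le _ _).trans_lt (max_lt ((degree_sum_le _ _).trans_lt ?_) ?_)
    · rw [Finset.sup_lt_iff (WithBot.bot_lt_coe _)]
      intro l hl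
      have : q ^ l < q ^ n := Nat.pow_lt_pow_right hq (Finset.mem_range.1 hl)
      refine (degree_add_le _ _).trans_lt (max_lt ?_ ?_)
      · rw [degree_X_pow]
        exact_mod_cast (by lia)
      · refine (degree_C_mul_X_pow_le _ _).trans_lt ?_
        exact_mod_cast (by lia)
    · exact degree_C_le.trans_lt (by exact_mod_cast (by lia))
  have heq : traceNumerator c q (n + 1) = X ^ (2 * q ^ n) +
      (∑ l ∈ Finset.range n, (X ^ (q ^ n + q ^ l) + C c * X ^ (q ^ n - q ^ l)) + C c) := by
    simp [traceNumerator, Finset.sum_range_succ, two_mul]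
    ring
  simp only [Nat.succ_eq_add_one, Nat.add_sub_cancel]
  rw [heq]
  refine ⟨monic_X_pow_add hlow, ?_⟩
  refine natDegree_eq_of_degree_eq_some ?_
  rw [degree_add_eq_left_of_degree_lt (by rwa [degree_X_pow]), degree_X_pow]

theorem aeval_traceNumerator {F A : Type*} [Field F] [CommRing A] [Algebra F A] (c : F) {q n : ℕ}
    (hq : 0 < q) {u v : A} (huv : u * v = 1) :
    aeval u (traceNumerator c q n) =
      u ^ q ^ (n - 1) * ∑ l ∈ Finset.range n, (u ^ q ^ l + algebraMap F A c * v ^ q ^ l) := by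
  simp only [traceNumerator, map_sum, map_add, map_mul, map_pow, aeval_X, aeval_C, Finset.mul_sum]
  refine Finset.sum_congr rfl fun l hl => ?_
  have hle : q ^ l ≤ q ^ (n - 1) := Nat.pow_le_pow_right hq (by grind)
  have : u ^ q ^ (n - 1) * v ^ q ^ l = u ^ (q ^ (n - 1) - q ^ l) := by
    rw [← Nat.sub_add_cancel hle, pow_add, mul_assoc, ← mul_pow, huv]
    simp
  rw [mul_add, ← pow_add, ← this]
  ring

theorem exists_trace_expansion {F : Type*} [Field F] {p : ℕ} [Fact p.Prime] [CharP F p]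
    {q m : ℕ} (hqm : q = p ^ m) (n : ℕ) (c υ : F) {S : Set F} (h0 : (0 : F) ∉ S)
    (hS : ∀ ξ ∈ S, ∑ l ∈ Finset.range n, (ξ ^ q ^ l + c * ξ⁻¹ ^ q ^ l) = υ) :
    HasLowDegreeCoeffs S fun ξ => ∑ l ∈ Finset.range n,
      ((PowerSeries.C ξ * (1 + PowerSeries.X)) ^ q ^ l +
        PowerSeries.C c * (PowerSeries.C ξ⁻¹ * (1 + PowerSeries.X)⁻¹) ^ q ^ l) := by
  have : CharP (PowerSeries F) p :=
    charP_of_injective_algebraMap (algebraMap F (PowerSeries F)).injective p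
  obtain ⟨ρ, hρ⟩ : (PowerSeries.X : PowerSeries F) ∣ (1 + PowerSeries.X)⁻¹ - 1 := by
    rw [PowerSeries.X_dvd_iff]
    simp
  have hρ' : (1 + PowerSeries.X : PowerSeries F)⁻¹ = 1 + PowerSeries.X * ρ := by
    rw [← hρ]; ring
  have hfrob (x : PowerSeries F) (l : ℕ) : (1 + x) ^ q ^ l = 1 + x ^ q ^ l := by
    rw [hqm, ← pow_mul, add_pow_char_pow, one_pow]
  have key : HasLowDegreeCoeffs S fun ξ => PowerSeries.C υ + ∑ l ∈ Finset.range n,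
      (PowerSeries.C (ξ ^ q ^ l) * PowerSeries.X ^ q ^ l +
        PowerSeries.C c * (PowerSeries.C (ξ⁻¹ ^ q ^ l) * (PowerSeries.X * ρ) ^ q ^ l)) := by
    refine (HasLowDegreeCoeffs.const _).add (HasLowDegreeCoeffs.sum _ fun l _ => ?_)
    exact (hasLowDegreeCoeffs_C_pow_mul_X_pow _).add ((HasLowDegreeCoeffs.const _).mul
      (hasLowDegreeCoeffs_C_inv_pow_mul h0 _ (pow_dvd_pow_of_dvd (dvd_mul_right _ _) _)))
  intro r
  obtain ⟨B, hB, hB'⟩ := key r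
  refine ⟨B, hB, fun ξ hξ => ?_⟩
  rw [← hB' ξ hξ]
  simp only [← hS ξ hξ, map_sum (PowerSeries.C (R := F)), ← Finset.sum_add_distrib]
  congr 2
  refine Finset.sum_congr rfl fun l _ => ?_
  rw [hρ', mul_pow, mul_pow, hfrob, hfrob]
  simp only [map_add, map_mul, map_pow]
  ring

theorem exponents_injective {q E M Q J : ℕ} (hE : E * (q - 1) + 1 = Q) (hM : M * q = Q)
    (hJ : J * (q * (q - 1)) ≤ Q) {j j' e e' i i' h h' : ℕ} (hj : j < J) (hj' : j' < J)
    (he : e < q - 1) (he' : e' < q - 1) (hi : i < q) (hi' : i' < q)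
    (heq : j + e * E + h * Q + i * M = j' + e' * E + h' * Q + i' * M) :
    j = j' ∧ e = e' ∧ i = i' ∧ h = h' := by
  obtain ⟨s, rfl⟩ : ∃ s, q = s + 1 := ⟨q - 1, by lia⟩
  simp only [Nat.add_sub_cancel] at *
  zify at *
  have key : (Q : ℤ) * (((e - e') + (h - h') * s) * (s + 1) + (i - i') * s) =
      (e - e') * (s + 1) - (j - j') * ((s + 1) * s) := by
    linear_combination ((s : ℤ) + 1) * s * heq - ((e : ℤ) - e') * (s + 1) * hE
      - ((i : ℤ) - i') * s * hM
  have hs : (0 : ℤ) ≤ s := by positivity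
  have h1 : ((e : ℤ) - e') * (s + 1) - (j - j') * ((s + 1) * s) = 0 := by
    refine Int.eq_zero_of_abs_lt_dvd ⟨_, key.symm⟩ (abs_lt.2 ⟨?_, ?_⟩)
    · have a1 : ((j : ℤ) - j') * ((s + 1) * s) ≤ (J - 1) * ((s + 1) * s) :=
        mul_le_mul_of_nonneg_right (by lia) (by positivity)
      have a2 : (-(s - 1) : ℤ) * (s + 1) ≤ (e - e') * (s + 1) :=
        mul_le_mul_of_nonneg_right (by lia) (by positivity)
      nlinarith
    · have a1 : (-(J - 1) : ℤ) * ((s + 1) * s) ≤ ((j : ℤ) - j') * ((s + 1) * s) :=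
        mul_le_mul_of_nonneg_right (by lia) (by positivity)
      have a2 : ((e : ℤ) - e') * (s + 1) ≤ (s - 1) * (s + 1) :=
        mul_le_mul_of_nonneg_right (by lia) (by positivity)
      nlinarith
  have hQ : (Q : ℤ) ≠ 0 := by
    rw [← hE]; positivity
  have h2 := (mul_eq_zero.1 (key.trans h1)).resolve_left hQ
  have h3 : (i : ℤ) - i' = 0 := by
    refine Int.eq_zero_of_abs_lt_dvd (m := s + 1)
      ⟨(e - e') + (h - h') * s + (i - i'), by linear_combination -h2⟩ (abs_lt.2 ⟨?_, ?_⟩) <;> lia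
  have h4 : ((e : ℤ) - e') + (h - h') * s = 0 := by
    rw [h3, zero_mul, add_zero] at h2
    exact (mul_eq_zero.1 h2).resolve_right (by positivity)
  have h5 : (e : ℤ) - e' = 0 := by
    refine Int.eq_zero_of_abs_lt_dvd (m := s) ⟨-(h - h'), by linear_combination h4⟩
      (abs_lt.2 ⟨?_, ?_⟩) <;> lia
  have hs0 : (s : ℤ) ≠ 0 := by lia
  have h6 : (h : ℤ) - h' = 0 := by
    rw [h5, zero_add] at h4
    exact (mul_eq_zero.1 h4).resolve_right hs0
  have h7 : (j : ℤ) - j' = 0 := by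
    rw [h5, zero_mul, zero_sub, neg_eq_zero] at h1
    exact (mul_eq_zero.1 h1).resolve_right (by positivity)
  refine ⟨?_, ?_, ?_, ?_⟩ <;> lia

theorem card_mul_le_of_trace_norm {F : Type*} [Field F] [Fintype F] {p : ℕ} [Fact p.Prime]
    [CharP F p] {q m n : ℕ} (hqm : q = p ^ m) (hm : m ≠ 0) (hn : n ≠ 0)
    (hF : Fintype.card F = q ^ n) (c υ w : F) (S : Finset F) (h0 : ∀ ξ ∈ S, ξ ≠ 0)
    (htr : ∀ ξ ∈ S, ∑ l ∈ Finset.range n, (ξ ^ q ^ l + c * ξ⁻¹ ^ q ^ l) = υ)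
    (hnorm : ∀ ξ ∈ S, ξ ^ ∑ l ∈ Finset.range n, q ^ l = w) (J H k : ℕ)
    (hJ : J * (q * (q - 1)) ≤ q ^ n) (hcard : k * (J + H + 2 * k) < J * H * (q * (q - 1))) :
    S.card * k ≤ (H + 3) * q ^ n := by
  have hq : 1 < q := hqm ▸ Nat.one_lt_pow hm (Fact.out : p.Prime).one_lt
  set E := ∑ l ∈ Finset.range n, q ^ l with hE
  set M := q ^ (n - 1) with hM
  have hMq : M * q = q ^ n := by rw [hM, ← pow_succ, Nat.sub_add_cancel (by lia)]
  have hEq : E * (q - 1) + 1 = q ^ n := by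
    have h1 : (E : ℤ) * (q - 1) = q ^ n - 1 := by
      rw [hE]
      push_cast
      exact geom_sum_mul _ _
    zify [hq.le]
    linarith
  obtain ⟨hmonic, hdeg⟩ := traceNumerator_monic_and_natDegree c hq hn
  let ι := Fin J × Fin (q - 1) × Fin q × Fin H
  let b : ι → ℕ := fun x => x.1 + x.2.1 * E + x.2.2.2 * q ^ n
  let P : ι → F[X] := fun x => X ^ (b x + (q - 1 - x.2.2.1) * M) * traceNumerator c q n ^ (x.2.2.1 : ℕ)
  have hPmonic (x) : (P x).Monic := (monic_X_pow _).mul (hmonic.pow _)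
  have hPdeg (x) : (P x).natDegree = b x + (q - 1) * M + x.2.2.1 * M := by
    have h1 : (x.2.2.1 : ℕ) ≤ q - 1 := by have := x.2.2.1.2; lia
    rw [Monic.natDegree_mul (monic_X_pow _) (hmonic.pow _), hmonic.natDegree_pow, hdeg,
      natDegree_X_pow]
    obtain ⟨d, hd⟩ := Nat.exists_eq_add_of_le h1
    have h2 : q - 1 - x.2.2.1 = d := by lia
    have h3 : (q - 1) * M = (x.2.2.1 + d) * M := by rw [← hd]
    rw [h2, h3]
    ring
  let u : F → PowerSeries F := fun ξ => PowerSeries.C ξ * (1 + PowerSeries.X)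
  let v : F → PowerSeries F := fun ξ => PowerSeries.C ξ⁻¹ * (1 + PowerSeries.X)⁻¹
  have huv (ξ) (hξ : ξ ≠ 0) : u ξ * v ξ = 1 := by
    have h1 : (1 + PowerSeries.X : PowerSeries F) * (1 + PowerSeries.X)⁻¹ = 1 :=
      PowerSeries.mul_inv_cancel _ (by simp)
    have h2 : PowerSeries.C ξ * PowerSeries.C ξ⁻¹ = (1 : PowerSeries F) := by
      rw [← map_mul, mul_inv_cancel₀ hξ, map_one]
    linear_combination (PowerSeries.C ξ * PowerSeries.C ξ⁻¹) * h1 + h2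
  let τ : F → PowerSeries F := fun ξ => ∑ l ∈ Finset.range n,
    (u ξ ^ q ^ l + PowerSeries.C c * v ξ ^ q ^ l)
  have hτ : HasLowDegreeCoeffs (S : Set F) τ :=
    exists_trace_expansion hqm n c υ (fun h => h0 0 h rfl) htr
  refine card_mul_le_of_local_expansions S h0 k (J + H + 2 * k) _ P (fun x => (hPmonic x).ne_zero)
    ?_ ?_ (fun ξ => u ξ ^ ((q - 1) * M)) (fun x ξ => u ξ ^ b x * τ ξ ^ (x.2.2.1 : ℕ)) ?_ ?_ ?_
  · intro x y hxy
    simp only [hPdeg, b] at hxy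
    obtain ⟨h1, h2, h3, h4⟩ := exponents_injective hEq hMq hJ x.1.2 y.1.2 x.2.1.2 y.2.1.2
      x.2.2.1.2 y.2.2.1.2 (h := x.2.2.2) (h' := y.2.2.2) (by lia)
    ext <;> assumption
  · intro x
    rw [hPdeg]
    have h1 : (x.2.1 : ℕ) * E ≤ (q - 1) * E := Nat.mul_le_mul_right _ x.2.1.2.le
    have h2 : (x.2.2.2 + 1) * q ^ n ≤ H * q ^ n := Nat.mul_le_mul_right _ x.2.2.2.2
    have h3 : ((q - 1) + x.2.2.1) * M ≤ (2 * q) * M :=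
      Nat.mul_le_mul_right _ (by have := x.2.2.1.2; lia)
    have h4 : (x.1 : ℕ) < J := x.1.2
    have h5 : J ≤ J * (q * (q - 1)) := Nat.le_mul_of_pos_right _ (Nat.mul_pos (by lia) (by lia))
    simp only [b]
    nlinarith
  · intro x ξ hξ
    have h1 : (x.2.2.1 : ℕ) ≤ q - 1 := by have := x.2.2.1.2; lia
    have h4 : aeval (u ξ) (traceNumerator c q n) = u ξ ^ M * τ ξ :=
      aeval_traceNumerator c (by lia : 0 < q) (huv ξ (h0 ξ hξ))
    change aeval (u ξ) (P x) = _
    simp only [P, map_mul, map_pow, aeval_X, h4]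
    obtain ⟨d, hd⟩ := Nat.exists_eq_add_of_le h1
    have h2 : q - 1 - x.2.2.1 = d := by lia
    have h3 : u ξ ^ ((q - 1) * M) = u ξ ^ ((x.2.2.1 + d) * M) := by rw [← hd]
    rw [h2, h3]
    ring
  · intro x r hr
    obtain ⟨B, hB, hB'⟩ := (HasLowDegreeCoeffs.const ((1 + PowerSeries.X : PowerSeries F) ^ b x)).mul
      (hτ.pow (x.2.2.1 : ℕ)) r
    refine ⟨C (w ^ (x.2.1 : ℕ)) * X ^ (x.1 + x.2.2.2 : ℕ) * B, ?_, fun ξ hξ => ?_⟩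
    · refine degree_le_natDegree.trans_lt (Nat.cast_lt.2 ?_)
      refine natDegree_mul_le.trans_lt
        ((Nat.add_le_add_right (natDegree_C_mul_X_pow_le _ _) _).trans_lt ?_)
      have := x.1.2
      have := x.2.2.2.2
      lia
    · have h2 : ξ ^ b x = w ^ (x.2.1 : ℕ) * ξ ^ (x.1 + x.2.2.2 : ℕ) := by
        simp only [b, pow_add]
        rw [mul_comm _ E, pow_mul, hnorm ξ hξ, mul_comm _ (q ^ n), pow_mul ξ (q ^ n), ← hF,
          FiniteField.pow_card]
        ring
      simp only [u, eval_mul, eval_C, eval_pow, eval_X]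
      rw [← hB' ξ hξ, ← h2, mul_pow, ← map_pow, mul_assoc, PowerSeries.coeff_C_mul]
      ring
  · simp only [ι, Fintype.card_prod, Fintype.card_fin]
    refine hcard.trans_eq ?_
    ring

end StepanovPolynomials

section PointCount

theorem card_mul_le_add_mul_sqrt {F : Type*} [Field F] [Fintype F] {p : ℕ} [Fact p.Prime]
    [CharP F p] {q m n K : ℕ} (hqm : q = p ^ m) (hm : m ≠ 0) (hn : n ≠ 0) (hq3 : 3 ≤ q)
    (hF : Fintype.card F = q ^ n) (hK : K ^ 2 = q ^ n) (c υ w : F) (S : Finset F)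
    (h0 : ∀ ξ ∈ S, ξ ≠ 0)
    (htr : ∀ ξ ∈ S, ∑ l ∈ Finset.range n, (ξ ^ q ^ l + c * ξ⁻¹ ^ q ^ l) = υ)
    (hnorm : ∀ ξ ∈ S, ξ ^ ∑ l ∈ Finset.range n, q ^ l = w) :
    q * (q - 1) * S.card ≤ q ^ n + q * (q - 1) * (q * (q - 1) + 8) * K := by
  have hD : 6 ≤ q * (q - 1) := Nat.mul_le_mul hq3 (by lia : 2 ≤ q - 1)
  have hmain := card_mul_le_of_trace_norm hqm hm hn hF c υ w S h0 htr hnorm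
  rw [← hK] at hmain ⊢
  generalize q * (q - 1) = D at *
  rcases lt_or_ge K D with hKD | hKD
  · have h1 : S.card ≤ K ^ 2 := hK ▸ hF ▸ S.card_le_univ
    nlinarith [Nat.zero_le (D * K), Nat.mul_le_mul_left D h1,
      Nat.mul_le_mul_left (D * K) hKD.le]
  · have h1 := hmain (K ^ 2 / D) (K / D + 5) K (Nat.div_mul_le_self _ _) (by
      have hJ1 : D * (K ^ 2 / D) ≤ K ^ 2 := Nat.mul_div_le _ _
      have hJ2 : K ^ 2 < D * (K ^ 2 / D) + D := Nat.lt_mul_div_succ _ (by lia)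
      have hH1 : D * (K / D) ≤ K := Nat.mul_div_le _ _
      have hH2 : K < D * (K / D) + D := Nat.lt_mul_div_succ _ (by lia)
      generalize K ^ 2 / D = J at *
      generalize K / D = H at *
      have h6 : 6 * H ≤ K := (Nat.mul_le_mul_right H hD).trans hH1
      have a1 : K * (6 * H) ≤ K * K := Nat.mul_le_mul_left K h6
      have a2 : J * (K + 4 * D + 1) ≤ J * (D * H + 5 * D) := Nat.mul_le_mul_left J (by lia)
      have a3 : 6 * K ≤ K * K := Nat.mul_le_mul_right K (by lia)
      nlinarith)
    have h2 : S.card ≤ (K / D + 8) * K :=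
      Nat.le_of_mul_le_mul_right (h1.trans_eq (by ring)) (by lia : 0 < K)
    have h3 : D * (K / D) ≤ K := Nat.mul_div_le _ _
    calc D * S.card ≤ D * ((K / D + 8) * K) := Nat.mul_le_mul_left D h2
      _ = (D * (K / D)) * K + 8 * D * K := by ring
      _ ≤ K * K + 8 * D * K := by gcongr
      _ ≤ K ^ 2 + D * (D + 8) * K := by nlinarith [Nat.zero_le (D * D * K)]

variable {k F : Type*} [Field k] [Fintype k] [Field F] [Fintype F] [Algebra k F]

theorem card_filter_trace_norm_le (hk : 3 ≤ Fintype.card k) (c υ w : k) (hw : w ≠ 0) {K : ℕ}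
    (hK : K ^ 2 = Fintype.card F) [DecidableEq k] :
    Fintype.card k * (Fintype.card k - 1) *
      (Finset.univ.filter fun ξ : F =>
        Algebra.trace k F (ξ + algebraMap k F c * ξ⁻¹) = υ ∧ Algebra.norm k ξ = w).card ≤
      Fintype.card F + Fintype.card k * (Fintype.card k - 1) *
        (Fintype.card k * (Fintype.card k - 1) + 8) * K := by
  obtain ⟨p, hp⟩ := CharP.exists k
  obtain ⟨m, hprime, hm⟩ := FiniteField.card k p
  have : Fact p.Prime := ⟨hprime⟩
  have : CharP F p := charP_of_injective_algebraMap (algebraMap k F).injective p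
  have hF := Module.card_eq_pow_finrank (K := k) (V := F)
  rw [hF] at hK ⊢
  refine card_mul_le_add_mul_sqrt hm m.ne_zero Module.finrank_pos.ne' hk hF hK
    (algebraMap k F c) (algebraMap k F υ) (algebraMap k F w) _ ?_ ?_ ?_
  all_goals
    intro ξ hξ
    obtain ⟨h1, h2⟩ := (Finset.mem_filter.1 hξ).2
  · rintro rfl
    exact hw (by rw [← h2, Algebra.norm_zero])
  · rw [← h1, map_add, map_add, ← Algebra.smul_def, map_smul, smul_eq_mul, map_mul,
      FiniteField.algebraMap_trace_eq_sum_pow, FiniteField.algebraMap_trace_eq_sum_pow,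
      Finset.mul_sum, ← Finset.sum_add_distrib, Nat.card_eq_fintype_card]
  · rw [← h2, FiniteField.algebraMap_norm_eq_pow_sum, Nat.card_eq_fintype_card]

end PointCount

section KloostermanSum

/-- The Kloosterman sum over `F` twisted by characters lifted from `k`. -/
noncomputable def kloostermanSum {k : Type*} (F : Type*) [Field k] [Field F] [Fintype F]
    [Algebra k F] (c : k) (ψ : AddChar k ℂ) (χ : MulChar k ℂ) : ℂ :=
  ∑ ξ : F, ψ (Algebra.trace k F (ξ + algebraMap k F c * ξ⁻¹)) * χ (Algebra.norm k ξ)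

theorem norm_mulChar_apply_le_one {k : Type*} [Field k] [Fintype k] (χ : MulChar k ℂ) (a : k) :
    ‖χ a‖ ≤ 1 := by
  by_cases ha : a = 0
  · simp [ha, MulChar.map_zero χ]
  · refine (Complex.norm_eq_one_of_pow_eq_one (n := Fintype.card k - 1) ?_ ?_).le
    · rw [← map_pow, FiniteField.pow_card_sub_one_eq_one a ha, map_one]
    · have := Fintype.one_lt_card (α := k)
      lia

theorem sum_addChar_mul_mulChar {k : Type*} [Field k] [Fintype k] {ψ : AddChar k ℂ}
    {χ : MulChar k ℂ} (h : ψ ≠ 1 ∨ χ ≠ 1) : ∑ x : k × k, ψ x.1 * χ x.2 = 0 := by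
  rw [Fintype.sum_prod_type, ← Fintype.sum_mul_sum]
  rcases h with h | h
  · rw [AddChar.sum_eq_zero_of_ne_one h, zero_mul]
  · rw [MulChar.sum_eq_zero_of_ne_one h, mul_zero]

theorem norm_kloostermanSum_le_mul_sqrt {k F : Type*} [Field k] [Fintype k] [Field F] [Fintype F]
    [Algebra k F] (hk : 3 ≤ Fintype.card k) (c : k) {ψ : AddChar k ℂ} {χ : MulChar k ℂ}
    (hψχ : ψ ≠ 1 ∨ χ ≠ 1) {K : ℕ} (hK : K ^ 2 = Fintype.card F) :
    ‖kloostermanSum F c ψ χ‖ ≤ ((Fintype.card k * (Fintype.card k - 1) *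
        (Fintype.card k * (Fintype.card k - 1) + 8) + 1 : ℕ) : ℝ) * K := by
  classical
  set D := Fintype.card k * (Fintype.card k - 1) with hD
  have hD0 : (0 : ℝ) < D := by
    rw [hD]; exact_mod_cast Nat.mul_pos (by lia) (by lia)
  let g : F → k × k := fun ξ =>
    (Algebra.trace k F (ξ + algebraMap k F c * ξ⁻¹), Algebra.norm k ξ)
  let ν : k × k → ℕ := fun x => (Finset.univ.filter fun ξ : F => g ξ = x).card
  let A : ℝ := Fintype.card F / D + (D + 8) * K
  have hν (x : k × k) (hx : x.2 ≠ 0) : (ν x : ℝ) ≤ A := by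
    have h1 := card_filter_trace_norm_le (F := F) hk c x.1 x.2 hx hK
    rw [← hD] at h1
    have h2 : (D : ℝ) * ν x ≤ Fintype.card F + D * (D + 8) * K := by
      simp only [ν, g, Prod.ext_iff]
      exact_mod_cast h1
    rw [← mul_le_mul_iff_right₀ hD0]
    refine h2.trans_eq ?_
    simp only [A]
    field_simp
  have hsum : kloostermanSum F c ψ χ = ∑ x : k × k, (ν x : ℂ) * (ψ x.1 * χ x.2) := by
    rw [kloostermanSum]
    have := Finset.sum_fiberwise' Finset.univ g fun x => ψ x.1 * χ x.2
    simp only [Finset.sum_const, nsmul_eq_mul] at this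
    exact this.symm
  have hsum' : kloostermanSum F c ψ χ =
      ∑ x : k × k with x.2 ≠ 0, ((ν x : ℂ) - A) * (ψ x.1 * χ x.2) := by
    have hne : ∀ x ∈ Finset.univ, ((ν x : ℂ) - A) * (ψ x.1 * χ x.2) ≠ 0 → x.2 ≠ 0 :=
      fun x _ hx h => hx (by simp [h, MulChar.map_zero χ])
    rw [Finset.sum_filter_of_ne hne]
    simp only [sub_mul, Finset.sum_sub_distrib, ← Finset.mul_sum, sum_addChar_mul_mulChar hψχ,
      mul_zero, sub_zero, hsum]
  have hcard : (Finset.univ.filter fun x : k × k => x.2 ≠ 0).card = D := by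
    rw [show (Finset.univ.filter fun x : k × k => x.2 ≠ 0) =
      Finset.univ ×ˢ (Finset.univ.erase (0 : k)) by ext; simp, Finset.card_product,
      Finset.card_erase_of_mem (Finset.mem_univ _), Finset.card_univ]
  have htotal : ∑ x : k × k with x.2 ≠ 0, ν x + 1 = Fintype.card F := by
    have hmaps : ∀ ξ ∈ (Finset.univ : Finset F).erase 0,
        g ξ ∈ Finset.univ.filter fun x : k × k => x.2 ≠ 0 := fun ξ hξ => by
      simpa [g, Algebra.norm_eq_zero_iff] using hξ
    rw [← Finset.card_univ, ← Finset.card_erase_add_one (Finset.mem_univ (0 : F)),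
      Finset.card_eq_sum_card_fiberwise hmaps]
    congr 1
    refine Finset.sum_congr rfl fun x hx => congrArg Finset.card ?_
    ext ξ
    simp only [Finset.mem_filter, Finset.mem_univ, Finset.mem_erase, true_and, and_true]
    refine ⟨fun h => ⟨?_, h⟩, And.right⟩
    rintro rfl
    rw [← h] at hx
    simp [g, Algebra.norm_zero] at hx
  have hKone : (1 : ℝ) ≤ K := by
    have : K ≠ 0 := by
      rintro rfl
      exact Fintype.card_ne_zero (α := F) (by rw [← hK]; simp)
    exact_mod_cast Nat.one_le_iff_ne_zero.2 this
  rw [hsum']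
  calc ‖∑ x : k × k with x.2 ≠ 0, ((ν x : ℂ) - A) * (ψ x.1 * χ x.2)‖
      ≤ ∑ x : k × k with x.2 ≠ 0, (A - ν x) := by
        refine norm_sum_le_of_le _ fun x hx => ?_
        rw [norm_mul, norm_mul, AddChar.norm_apply, one_mul, ← Complex.ofReal_natCast,
          ← Complex.ofReal_sub, Complex.norm_real, Real.norm_eq_abs, abs_sub_comm,
          abs_of_nonneg (sub_nonneg.2 (hν x (Finset.mem_filter.1 hx).2))]
        refine mul_le_of_le_one_right (sub_nonneg.2 (hν x (Finset.mem_filter.1 hx).2)) ?_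
        exact norm_mulChar_apply_le_one χ x.2
    _ = D * A - (Fintype.card F - 1) := by
        rw [Finset.sum_sub_distrib, Finset.sum_const, hcard, nsmul_eq_mul, ← htotal]
        push_cast
        ring
    _ = D * (D + 8) * K + 1 := by
        simp only [A]
        field_simp
        ring
    _ ≤ _ := by
        push_cast
        linarith

end KloostermanSum

section QuadraticExtension

theorem exists_algebraMap_eq_of_pow_card_eq {k F : Type*} [Field k] [Fintype k] [Field F]
    [Finite F] [Algebra k F] {x : F} (hx : x ^ Fintype.card k = x) :
    ∃ y : k, algebraMap k F y = x := by
  obtain ⟨p, hp⟩ := CharP.exists k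
  have : Fact p.Prime := ⟨CharP.char_is_prime k p⟩
  have hbot : x ∈ (⊥ : IntermediateField k F) := by
    refine (IsGalois.mem_bot_iff_fixed x).2 fun f => ?_
    obtain ⟨i, hi⟩ := FiniteField.exists_forall_apply_eq_pow k p F f
    rw [hi, Nat.card_eq_fintype_card]
    clear hi
    induction i with
    | zero => simp
    | succ i ih => rw [pow_succ, pow_mul, ih, hx]
  exact IntermediateField.mem_bot.1 hbot

variable {F L : Type*} [Field F] [Fintype F] [Field L] [Fintype L] [Algebra F L]

theorem algebraMap_trace_norm_of_finrank_eq_two (h : Module.finrank F L = 2) (ξ : L) :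
    algebraMap F L (Algebra.trace F L ξ) = ξ + FiniteField.frobeniusAlgHom F L ξ ∧
      algebraMap F L (Algebra.norm F ξ) = ξ * FiniteField.frobeniusAlgHom F L ξ := by
  rw [FiniteField.algebraMap_trace_eq_sum_pow, FiniteField.algebraMap_norm_eq_prod_pow, h]
  simp [Finset.sum_range_succ, Finset.prod_range_succ]

theorem frobeniusAlgHom_apply_apply (h : Module.finrank F L = 2) (ξ : L) :
    FiniteField.frobeniusAlgHom F L (FiniteField.frobeniusAlgHom F L ξ) = ξ := by
  simp only [FiniteField.coe_frobeniusAlgHom]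
  rw [← pow_mul, ← sq, ← h, ← Module.card_eq_pow_finrank, FiniteField.pow_card]

theorem exists_sq_eq_algebraMap (h : Module.finrank F L = 2) (h2 : (2 : F) ≠ 0) (a : F) :
    ∃ δ : L, δ ^ 2 = algebraMap F L a := by
  by_cases ha : a = 0
  · exact ⟨0, by simp [ha]⟩
  have hL : ringChar L ≠ 2 := by
    rw [← Algebra.ringChar_eq F L]
    intro h'
    exact h2 (by simpa [h'] using CharP.cast_eq_zero F (ringChar F))
  have hodd : Fintype.card F % 2 = 1 := FiniteField.odd_card_of_char_ne_two
    (by rwa [Algebra.ringChar_eq F L])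
  have hpow : algebraMap F L a ^ (Fintype.card L / 2) = 1 := by
    obtain ⟨j, hj⟩ : ∃ j, Fintype.card F = 2 * j + 1 := ⟨Fintype.card F / 2, by lia⟩
    have : Fintype.card L / 2 = (Fintype.card F - 1) * (j + 1) := by
      rw [Module.card_eq_pow_finrank (K := F), h, hj]
      have : (2 * j + 1) ^ 2 = 2 * (2 * j * (j + 1)) + 1 := by ring
      rw [this]
      simp only [Nat.add_sub_cancel]
      lia
    rw [this, pow_mul, ← map_pow, FiniteField.pow_card_sub_one_eq_one a ha, map_one, one_pow]
  obtain ⟨δ, hδ⟩ := (FiniteField.isSquare_iff hL (by simpa using ha)).2 hpow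
  exact ⟨δ, by rw [hδ, sq]⟩

theorem sub_eq_or_sub_eq_neg_of_sq_eq {R : Type*} [CommRing R] [IsDomain R] {x y s m e : R}
    (hs : x + y = s) (hm : x * y = m) (he : e ^ 2 = s ^ 2 - 4 * m) : x - y = e ∨ x - y = -e := by
  apply sq_eq_sq_iff_eq_or_eq_neg.1
  rw [he, ← hs, ← hm]
  ring

theorem filter_add_mul_eq [DecidableEq F] (h2 : (2 : F) ≠ 0) {s m d : F}
    (hd : d ^ 2 = s ^ 2 - 4 * m) :
    (Finset.univ.filter fun x : F × F => x.1 + x.2 = s ∧ x.1 * x.2 = m) =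
      {((s + d) / 2, (s - d) / 2), ((s - d) / 2, (s + d) / 2)} := by
  have h4 : (4 : F) ≠ 0 := by
    rw [show (4 : F) = 2 * 2 by norm_num]
    exact mul_ne_zero h2 h2
  ext ⟨x, y⟩
  simp only [Finset.mem_filter, Finset.mem_univ, true_and, Finset.mem_insert,
    Finset.mem_singleton, Prod.mk.injEq]
  constructor
  · rintro ⟨hs, hm⟩
    rcases sub_eq_or_sub_eq_neg_of_sq_eq hs hm hd with h | h
    · exact .inl ⟨by field_simp; linear_combination hs + h, by field_simp; linear_combination hs - h⟩
    · exact .inr ⟨by field_simp; linear_combination hs + h, by field_simp; linear_combination hs - h⟩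
  · rintro (⟨rfl, rfl⟩ | ⟨rfl, rfl⟩) <;>
      exact ⟨by field_simp; ring, mul_left_cancel₀ h4 (by field_simp; linear_combination -hd)⟩

theorem card_filter_add_mul_add_card_filter_trace_norm [DecidableEq F]
    (h : Module.finrank F L = 2) (h2 : (2 : F) ≠ 0) (z : F × F) :
    (Finset.univ.filter fun x : F × F => (x.1 + x.2, x.1 * x.2) = z).card +
      (Finset.univ.filter fun ξ : L => (Algebra.trace F L ξ, Algebra.norm F ξ) = z).card = 2 := by
  classical
  have : NeZero (2 : F) := ⟨h2⟩
  obtain ⟨s, m⟩ := z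
  obtain ⟨δ, hδ⟩ := exists_sq_eq_algebraMap (L := L) h h2 (s ^ 2 - 4 * m)
  set σ := FiniteField.frobeniusAlgHom F L with hσ
  have hinj := (algebraMap F L).injective
  have h2L : (2 : L) ≠ 0 := by
    rw [← map_ofNat (algebraMap F L) 2]
    exact (map_ne_zero (algebraMap F L)).2 h2
  have h4L : (4 : L) ≠ 0 := by
    rw [show (4 : L) = 2 * 2 by norm_num]
    exact mul_ne_zero h2L h2L
  have hmem (ξ : L) : (Algebra.trace F L ξ, Algebra.norm F ξ) = (s, m) ↔
      ξ + σ ξ = algebraMap F L s ∧ ξ * σ ξ = algebraMap F L m := by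
    obtain ⟨h1, h2⟩ := algebraMap_trace_norm_of_finrank_eq_two h ξ
    rw [Prod.ext_iff, ← h1, ← h2, hinj.eq_iff, hinj.eq_iff]
  simp only [hmem, Prod.mk.injEq]
  have hσδ : σ δ = δ ∨ σ δ = -δ := by
    apply sq_eq_sq_iff_eq_or_eq_neg.1
    rw [← map_pow, hδ, AlgHom.commutes]
  have hδ' : δ ^ 2 = algebraMap F L s ^ 2 - 4 * algebraMap F L m := by
    rw [hδ, map_sub, map_pow, map_mul, map_ofNat]
  have hσs (e : L) (he : σ e = e) (ξ : L) (hξ : ξ - σ ξ = e) : e = 0 := by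
    have h1 := congrArg σ hξ
    rw [map_sub, frobeniusAlgHom_apply_apply h, he] at h1
    exact (mul_eq_zero.1 (show 2 * e = 0 by linear_combination - hξ - h1)).resolve_left h2L
  by_cases hσδ1 : σ δ = δ
  · obtain ⟨d, rfl⟩ := exists_algebraMap_eq_of_pow_card_eq (k := F) (x := δ) hσδ1
    have hd : d ^ 2 = s ^ 2 - 4 * m := hinj (by rw [map_pow, hδ])
    rw [filter_add_mul_eq h2 hd]
    by_cases hd0 : d = 0
    · have hL : (Finset.univ.filter fun ξ : L => ξ + σ ξ = algebraMap F L s ∧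
          ξ * σ ξ = algebraMap F L m) = {algebraMap F L (s / 2)} := by
        ext ξ
        simp only [Finset.mem_filter, Finset.mem_univ, true_and, Finset.mem_singleton]
        constructor
        · rintro ⟨hs, hm⟩
          have h3 := sub_eq_or_sub_eq_neg_of_sq_eq hs hm hδ'
          simp only [hd0, map_zero, neg_zero, or_self] at h3
          rw [map_div₀, map_ofNat]
          field_simp
          linear_combination hs + h3
        · rintro rfl
          rw [AlgHom.commutes, ← map_add, ← map_mul, add_halves]
          refine ⟨rfl, congrArg _ (mul_left_cancel₀ (mul_ne_zero h2 h2) ?_)⟩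
          field_simp
          linear_combination -hd + d * hd0
      simp [hL, hd0]
    · have hL : (Finset.univ.filter fun ξ : L => ξ + σ ξ = algebraMap F L s ∧
          ξ * σ ξ = algebraMap F L m) = ∅ := by
        refine Finset.filter_eq_empty_iff.2 fun ξ _ => ?_
        rintro ⟨hs, hm⟩
        rcases sub_eq_or_sub_eq_neg_of_sq_eq hs hm hδ' with h3 | h3
        · have := hσs _ hσδ1 ξ h3
          simp [hd0] at this
        · have := hσs _ (by rw [map_neg, hσδ1]) ξ h3
          simp [hd0] at this
      rw [hL, Finset.card_empty, Finset.card_pair]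
      intro h3
      rw [Prod.mk.injEq] at h3
      have h4 := h3.1
      field_simp at h4
      exact hd0 ((mul_eq_zero.1 (show 2 * d = 0 by linear_combination h4)).resolve_left h2)
  · have hσδ2 := hσδ.resolve_left hσδ1
    have hδ0 : δ ≠ 0 := by
      rintro rfl
      simp at hσδ1
    have hF : (Finset.univ.filter fun x : F × F => x.1 + x.2 = s ∧ x.1 * x.2 = m) = ∅ := by
      refine Finset.filter_eq_empty_iff.2 fun x _ => ?_
      rintro ⟨hs, hm⟩
      have hs' : algebraMap F L x.1 + algebraMap F L x.2 = algebraMap F L s := by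
        rw [← map_add, hs]
      have hm' : algebraMap F L x.1 * algebraMap F L x.2 = algebraMap F L m := by
        rw [← map_mul, hm]
      apply hσδ1
      rcases sub_eq_or_sub_eq_neg_of_sq_eq hs' hm' hδ' with h3 | h3
      · rw [← h3, ← map_sub, AlgHom.commutes]
      · rw [← neg_eq_iff_eq_neg] at h3
        rw [← h3, ← map_sub, ← map_neg, AlgHom.commutes]
    have hL : (Finset.univ.filter fun ξ : L => ξ + σ ξ = algebraMap F L s ∧
        ξ * σ ξ = algebraMap F L m) =
          {(algebraMap F L s + δ) / 2, (algebraMap F L s - δ) / 2} := by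
      ext ξ
      simp only [Finset.mem_filter, Finset.mem_univ, true_and, Finset.mem_insert,
        Finset.mem_singleton]
      constructor
      · rintro ⟨hs, hm⟩
        rcases sub_eq_or_sub_eq_neg_of_sq_eq hs hm hδ' with h3 | h3
        · left
          field_simp
          linear_combination hs + h3
        · right
          field_simp
          linear_combination hs + h3
      · rintro (rfl | rfl)
        all_goals
          simp only [map_div₀, map_add, map_sub, map_ofNat, hσδ2, AlgHom.commutes]
          refine ⟨by field_simp; ring, mul_left_cancel₀ h4L ?_⟩
          field_simp
          linear_combination -hδ'
    rw [hF, hL, Finset.card_empty, Finset.card_pair]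
    intro h4
    field_simp at h4
    exact hδ0 ((mul_eq_zero.1 (show 2 * δ = 0 by linear_combination h4)).resolve_left h2L)

theorem sum_add_mul_add_sum_trace_norm (h : Module.finrank F L = 2) (h2 : (2 : F) ≠ 0)
    (Λ : F × F → ℂ) :
    ∑ x : F × F, Λ (x.1 + x.2, x.1 * x.2) +
      ∑ ξ : L, Λ (Algebra.trace F L ξ, Algebra.norm F ξ) = 2 * ∑ z : F × F, Λ z := by
  classical
  rw [← Finset.sum_fiberwise' Finset.univ (fun x : F × F => (x.1 + x.2, x.1 * x.2)) Λ,
    ← Finset.sum_fiberwise' Finset.univ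
      (fun ξ : L => (Algebra.trace F L ξ, Algebra.norm F ξ)) Λ, ← Finset.sum_add_distrib,
    Finset.mul_sum]
  refine Finset.sum_congr rfl fun z _ => ?_
  rw [Finset.sum_const, Finset.sum_const, ← add_nsmul, nsmul_eq_mul]
  congr 1
  have := card_filter_add_mul_add_card_filter_trace_norm (L := L) h h2 z
  exact_mod_cast this

end QuadraticExtension

section KloostermanRecursion

variable {k F : Type*} [Field k] [Field F] [Fintype F] [Algebra k F]

theorem sum_addChar_trace_mul [Fintype k] [DecidableEq F] {ψ : AddChar k ℂ} (hψ : ψ ≠ 1) (a : F) :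
    ∑ s : F, ψ (Algebra.trace k F (s * a)) = if a = 0 then (Fintype.card F : ℂ) else 0 := by
  have hprim : (ψ.compAddMonoidHom (Algebra.trace k F).toAddMonoidHom).IsPrimitive := by
    refine AddChar.IsPrimitive.of_ne_one fun h => hψ ?_
    ext x
    obtain ⟨y, rfl⟩ := Algebra.trace_surjective k F x
    exact DFunLike.congr_fun h y
  simpa using AddChar.sum_mulShift a hprim

theorem sum_mulChar_norm {χ : MulChar k ℂ} (hχ : χ ≠ 1) :
    ∑ m : F, χ (Algebra.norm k m) = 0 := by
  obtain ⟨u, hu⟩ := MulChar.ne_one_iff.1 hχ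
  obtain ⟨a, ha⟩ := FiniteField.norm_surjective k F u
  have ha0 : a ≠ 0 := by
    rintro rfl
    exact u.ne_zero (by rw [← ha, Algebra.norm_zero])
  have h : χ u * ∑ m : F, χ (Algebra.norm k m) = ∑ m : F, χ (Algebra.norm k m) := by
    rw [Finset.mul_sum, ← Equiv.sum_comp (Equiv.mulLeft₀ a ha0) fun m => χ (Algebra.norm k m)]
    simp [ha]
  exact (mul_eq_zero.1 (show (χ u - 1) * ∑ m : F, χ (Algebra.norm k m) = 0 by
    linear_combination h)).resolve_left (sub_ne_zero.2 hu)

/-- The summand of a Kloosterman sum in terms of the two symmetric functions of a conjugate pair. -/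
noncomputable def symmetricSummand (F : Type*) [Field F] [Algebra k F] (c : k) (ψ : AddChar k ℂ)
    (χ : MulChar k ℂ) (z : F × F) : ℂ :=
  ψ (Algebra.trace k F (z.1 + algebraMap k F c * (z.1 * z.2⁻¹))) * χ (Algebra.norm k z.2)

theorem norm_sum_symmetricSummand_le [Fintype k] {c : k} (hc : c ≠ 0) {ψ : AddChar k ℂ}
    {χ : MulChar k ℂ} (hψχ : ψ ≠ 1 ∨ χ ≠ 1) : ‖∑ z : F × F, symmetricSummand F c ψ χ z‖ ≤ Fintype.card F := by
  classical
  have hsum : ∑ z : F × F, symmetricSummand F c ψ χ z = ∑ m : F,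
      (∑ s : F, ψ (Algebra.trace k F (s * (1 + algebraMap k F c * m⁻¹)))) *
        χ (Algebra.norm k m) := by
    rw [Fintype.sum_prod_type, Finset.sum_comm]
    refine Finset.sum_congr rfl fun m _ => ?_
    rw [Finset.sum_mul]
    refine Finset.sum_congr rfl fun s _ => ?_
    simp only [symmetricSummand]
    ring_nf
  rw [hsum]
  by_cases hψ : ψ = 1
  · simp [hψ, ← Finset.mul_sum, sum_mulChar_norm (hψχ.resolve_left (not_not.2 hψ))]
  · have hiff (m : F) : 1 + algebraMap k F c * m⁻¹ = 0 ↔ m = -algebraMap k F c := by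
      by_cases hm : m = 0
      · simp [hm, hc]
      · rw [eq_neg_iff_add_eq_zero, ← mul_right_inj' hm (b := 1 + _), mul_zero]
        field_simp
    simp only [sum_addChar_trace_mul hψ, hiff, ite_mul, zero_mul, Finset.sum_ite_eq',
      Finset.mem_univ, if_true]
    rw [norm_mul, Complex.norm_natCast]
    exact mul_le_of_le_one_right (Nat.cast_nonneg _) (norm_mulChar_apply_le_one χ _)

theorem norm_kloostermanSum_sq_le [Fintype k] {L : Type*} [Field L] [Fintype L] [Algebra F L] [Algebra k L]
    [IsScalarTower k F L] (h : Module.finrank F L = 2) (h2 : (2 : F) ≠ 0) {c : k} (hc : c ≠ 0)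
    {ψ : AddChar k ℂ} {χ : MulChar k ℂ} (hψχ : ψ ≠ 1 ∨ χ ≠ 1) :
    ‖kloostermanSum F c ψ χ‖ ^ 2 ≤ 2 * Fintype.card F + ‖kloostermanSum L c ψ χ‖ := by
  have hF : kloostermanSum F c ψ χ ^ 2 =
      ∑ x : F × F, symmetricSummand F c ψ χ (x.1 + x.2, x.1 * x.2) := by
    rw [sq, kloostermanSum, Fintype.sum_mul_sum, Fintype.sum_prod_type]
    refine Finset.sum_congr rfl fun x _ => Finset.sum_congr rfl fun y _ => ?_
    by_cases hx : x = 0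
    · simp [symmetricSummand, hx, Algebra.norm_zero, MulChar.map_zero χ]
    by_cases hy : y = 0
    · simp [symmetricSummand, hy, Algebra.norm_zero, MulChar.map_zero χ]
    have h1 : (x + y) + algebraMap k F c * ((x + y) * (x * y)⁻¹) =
        (x + algebraMap k F c * x⁻¹) + (y + algebraMap k F c * y⁻¹) := by
      field_simp
      ring
    have h2 (a b : F) : ψ (Algebra.trace k F (a + b)) =
        ψ (Algebra.trace k F a) * ψ (Algebra.trace k F b) := by
      rw [map_add, AddChar.map_add_eq_mul]
    rw [symmetricSummand, h1, h2 (x + _), map_mul (Algebra.norm k), map_mul χ]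
    ring
  have hL : kloostermanSum L c ψ χ =
      ∑ ξ : L, symmetricSummand F c ψ χ (Algebra.trace F L ξ, Algebra.norm F ξ) := by
    rw [kloostermanSum]
    refine Finset.sum_congr rfl fun ξ _ => ?_
    by_cases hξ : ξ = 0
    · simp [symmetricSummand, hξ, Algebra.norm_zero, MulChar.map_zero χ]
    have hinv : Algebra.trace F L ξ⁻¹ = Algebra.trace F L ξ * (Algebra.norm F ξ)⁻¹ := by
      apply (algebraMap F L).injective
      have hσ : FiniteField.frobeniusAlgHom F L ξ ≠ 0 := (map_ne_zero _).2 hξ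
      rw [map_mul, map_inv₀ (algebraMap F L), (algebraMap_trace_norm_of_finrank_eq_two h ξ).1,
        (algebraMap_trace_norm_of_finrank_eq_two h ξ).2,
        (algebraMap_trace_norm_of_finrank_eq_two h ξ⁻¹).1, map_inv₀]
      field_simp
      ring
    have htr : Algebra.trace F L (ξ + algebraMap k L c * ξ⁻¹) = Algebra.trace F L ξ +
        algebraMap k F c * (Algebra.trace F L ξ * (Algebra.norm F ξ)⁻¹) := by
      rw [map_add, IsScalarTower.algebraMap_apply k F L, ← Algebra.smul_def, map_smul, hinv,
        smul_eq_mul]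
    rw [symmetricSummand, ← htr, Algebra.trace_trace, Algebra.norm_norm]
  have htotal := sum_add_mul_add_sum_trace_norm (L := L) h h2 (symmetricSummand F c ψ χ)
  rw [← hF, ← hL] at htotal
  rw [← norm_pow, eq_sub_of_add_eq htotal]
  refine (norm_sub_le _ _).trans ?_
  rw [norm_mul, Complex.norm_ofNat]
  gcongr
  exact norm_sum_symmetricSummand_le hc hψχ

end KloostermanRecursion

section WeilBound

variable {k : Type*} [Field k] [Fintype k] {c : k} {ψ : AddChar k ℂ} {χ : MulChar k ℂ}

theorem norm_kloostermanSum_sq_le_of_forall_even {F : Type*} [Field F] [Fintype F] [Algebra k F]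
    (h2 : (2 : k) ≠ 0) (hc : c ≠ 0) (hψχ : ψ ≠ 1 ∨ χ ≠ 1) {C : ℝ}
    (hbound : ∀ (L : Type) [Field L] [Fintype L] [Algebra k L], Even (Module.finrank k L) →
      ‖kloostermanSum L c ψ χ‖ ≤ C * √(Fintype.card L)) :
    ‖kloostermanSum F c ψ χ‖ ^ 2 ≤ (2 + C) * Fintype.card F := by
  obtain ⟨p, hp⟩ := CharP.exists F
  have : Fact p.Prime := ⟨CharP.char_is_prime F p⟩
  let L := FiniteField.Extension F p 2
  let _ : Fintype L := Fintype.ofFinite L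
  let _ : Algebra k L := ((algebraMap F L).comp (algebraMap k F)).toAlgebra
  have : IsScalarTower k F L := IsScalarTower.of_algebraMap_eq fun _ => rfl
  have hrank : Module.finrank F L = 2 := FiniteField.finrank_extension F p 2
  have hL := hbound L
    (by rw [← Module.finrank_mul_finrank k F L, hrank]; exact even_two.mul_left _)
  rw [Module.card_eq_pow_finrank (K := F) (V := L), hrank, Nat.cast_pow,
    Real.sqrt_sq (Nat.cast_nonneg _)] at hL
  have h2F : (2 : F) ≠ 0 := by
    rw [← map_ofNat (algebraMap k F) 2]
    exact (map_ne_zero _).2 h2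
  linarith [norm_kloostermanSum_sq_le hrank h2F hc hψχ]

/-- Passing to a quadratic extension sharpens the constant `C` in a bound `C * √(card F)`
towards `2`. -/
theorem norm_kloostermanSum_le_of_even_finrank (h2 : (2 : k) ≠ 0) (hc : c ≠ 0)
    (hψχ : ψ ≠ 1 ∨ χ ≠ 1) {C : ℝ} (hC : 0 ≤ C)
    (hbound : ∀ (F : Type) [Field F] [Fintype F] [Algebra k F], Even (Module.finrank k F) →
      ‖kloostermanSum F c ψ χ‖ ≤ C * √(Fintype.card F)) (r : ℕ) :
    ∀ (F : Type) [Field F] [Fintype F] [Algebra k F], Even (Module.finrank k F) →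
      ‖kloostermanSum F c ψ χ‖ ≤ (2 + C / 4 ^ r) * √(Fintype.card F) := by
  induction r with
  | zero =>
    intro F _ _ _ hF
    refine (hbound F hF).trans ?_
    gcongr
    simp
  | succ r ih =>
    intro F _ _ _ _
    have hstep := norm_kloostermanSum_sq_le_of_forall_even (F := F) h2 hc hψχ ih
    refine le_of_sq_le_sq ?_ (by positivity)
    rw [mul_pow, Real.sq_sqrt (Nat.cast_nonneg _)]
    have hx : C / 4 ^ (r + 1) = C / 4 ^ r / 4 := by rw [pow_succ, div_div]
    rw [hx]
    nlinarith [mul_nonneg (sq_nonneg (C / 4 ^ r)) (Nat.cast_nonneg (α := ℝ) (Fintype.card F))]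

theorem norm_kloostermanSum_le {F : Type*} [Field F] [Fintype F] [Algebra k F]
    (h2 : (2 : k) ≠ 0) (hc : c ≠ 0) (hψχ : ψ ≠ 1 ∨ χ ≠ 1) :
    ‖kloostermanSum F c ψ χ‖ ≤ 2 * √(Fintype.card F) := by
  have hk : 3 ≤ Fintype.card k := by
    have h1 := Fintype.one_lt_card (α := k)
    have h3 : ringChar k ≠ 2 := fun h => h2 (by simpa [h] using CharP.cast_eq_zero k (ringChar k))
    have := FiniteField.odd_card_of_char_ne_two h3
    lia
  have heven (E : Type) [Field E] [Fintype E] [Algebra k E] (hE : Even (Module.finrank k E)) :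
      ‖kloostermanSum E c ψ χ‖ ≤ 2 * √(Fintype.card E) := by
    have hlim := norm_kloostermanSum_le_of_even_finrank h2 hc hψχ (Nat.cast_nonneg _)
      fun E _ _ _ hE => by
        obtain ⟨j, hj⟩ := hE
        have hK : (Fintype.card k ^ j) ^ 2 = Fintype.card E := by
          rw [Module.card_eq_pow_finrank (K := k) (V := E), hj]
          ring
        refine (norm_kloostermanSum_le_mul_sqrt hk c hψχ hK).trans_eq ?_
        rw [← hK, Nat.cast_pow (_ ^ j) 2, Real.sqrt_sq (Nat.cast_nonneg _)]
    refine ge_of_tendsto' (x := Filter.atTop) ?_ fun r => hlim r E hE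
    have h4 := tendsto_pow_atTop_nhds_zero_of_lt_one (r := (4 : ℝ)⁻¹) (by norm_num) (by norm_num)
    simpa [div_eq_mul_inv] using ((h4.const_mul _).const_add 2).mul_const √(Fintype.card E)
  refine le_of_sq_le_sq ?_ (by positivity)
  rw [mul_pow, Real.sq_sqrt (Nat.cast_nonneg _)]
  linarith [norm_kloostermanSum_sq_le_of_forall_even (F := F) h2 hc hψχ heven]

end WeilBound

section Existence

variable {k : Type*} [Field k]

theorem sum_mulChar_apply_eq_zero [Fintype k] [Fintype (MulChar k ℂ)] {a : k} (ha : a ≠ 1) :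
    ∑ χ : MulChar k ℂ, χ a = 0 := by
  obtain ⟨η, hη⟩ := MulChar.exists_apply_ne_one_of_hasEnoughRootsOfUnity k ℂ ha
  have h : η a * ∑ χ : MulChar k ℂ, χ a = ∑ χ : MulChar k ℂ, χ a := by
    rw [Finset.mul_sum, ← Equiv.sum_comp (Equiv.mulLeft η) fun χ : MulChar k ℂ => χ a]
    simp
  exact (mul_eq_zero.1 (show (η a - 1) * ∑ χ : MulChar k ℂ, χ a = 0 by
    linear_combination h)).resolve_left (sub_ne_zero.2 hη)

theorem card_addChar_prod_mulChar [Fintype k] [Fintype (MulChar k ℂ)] :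
    Fintype.card (AddChar k ℂ × MulChar k ℂ) = Fintype.card k * (Fintype.card k - 1) := by
  rw [Fintype.card_prod, AddChar.card_eq, ← Nat.card_eq_fintype_card (α := MulChar k ℂ),
    MulChar.card_eq_card_units_of_hasEnoughRootsOfUnity, Nat.card_units, Nat.card_eq_fintype_card]

theorem kloostermanSum_one_one {F : Type*} [Field F] [Fintype F] [Algebra k F] (c : k) :
    kloostermanSum F c 1 1 = Fintype.card F - 1 := by
  classical
  have h (ξ : F) : (1 : MulChar k ℂ) (Algebra.norm k ξ) = if ξ = 0 then 0 else 1 := by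
    split_ifs with hξ
    · rw [hξ, Algebra.norm_zero, MulChar.map_zero]
    · exact MulChar.one_apply (Ne.isUnit (Algebra.norm_ne_zero_iff.2 hξ))
  simp only [kloostermanSum, AddChar.one_apply, one_mul, h]
  rw [Finset.sum_ite, Finset.sum_const_zero, zero_add, Finset.sum_const, nsmul_one,
    Finset.filter_ne', Finset.card_erase_of_mem (Finset.mem_univ _), Finset.card_univ,
    Nat.cast_pred Fintype.card_pos]

theorem exists_trace_eq_and_norm_eq [Fintype k] {F : Type*} [Field F] [Fintype F] [Algebra k F]
    (h2 : (2 : k) ≠ 0) {c : k} (hc : c ≠ 0) (υ : k) {w : k} (hw : w ≠ 0)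
    (hcard : 2 * ((Fintype.card k * (Fintype.card k - 1) : ℕ) - 1 : ℝ) * √(Fintype.card F) <
      Fintype.card F - 1) :
    ∃ ξ : F, Algebra.trace k F (ξ + algebraMap k F c * ξ⁻¹) = υ ∧ Algebra.norm k ξ = w := by
  classical
  by_contra! hne
  have : Fintype (MulChar k ℂ) := Fintype.ofFinite _
  let f : AddChar k ℂ × MulChar k ℂ → ℂ := fun z =>
    z.1 (-υ) * z.2 w⁻¹ * kloostermanSum F c z.1 z.2
  have hzero : ∑ z, f z = 0 := by
    have hswap : ∑ z, f z = ∑ ξ : F,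
        (∑ ψ : AddChar k ℂ, ψ (-υ + Algebra.trace k F (ξ + algebraMap k F c * ξ⁻¹))) *
          ∑ χ : MulChar k ℂ, χ (w⁻¹ * Algebra.norm k ξ) := by
      simp only [f, kloostermanSum, Fintype.sum_mul_sum]
      simp only [Finset.mul_sum]
      rw [Finset.sum_comm]
      refine Finset.sum_congr rfl fun ξ _ => ?_
      rw [Fintype.sum_prod_type]
      refine Finset.sum_congr rfl fun ψ _ => Finset.sum_congr rfl fun χ _ => ?_
      rw [AddChar.map_add_eq_mul, map_mul]
      ring
    rw [hswap]
    refine Finset.sum_eq_zero fun ξ _ => ?_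
    by_cases hξ : Algebra.trace k F (ξ + algebraMap k F c * ξ⁻¹) = υ
    · rw [sum_mulChar_apply_eq_zero, mul_zero]
      rw [Ne, inv_mul_eq_one₀ hw]
      exact (hne ξ hξ).symm
    · rw [AddChar.sum_apply_eq_ite, if_neg, zero_mul]
      rw [neg_add_eq_zero]
      exact fun h => hξ h.symm
  have hone : f (1, 1) = Fintype.card F - 1 := by
    simp only [f, AddChar.one_apply, MulChar.one_apply (Ne.isUnit (inv_ne_zero hw)), one_mul,
      kloostermanSum_one_one]
  have hrest (z : AddChar k ℂ × MulChar k ℂ) (hz : z ∈ Finset.univ.erase (1, 1)) :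
      ‖f z‖ ≤ 2 * √(Fintype.card F) := by
    have hz' : z.1 ≠ 1 ∨ z.2 ≠ 1 := by
      rw [← not_and_or]
      exact fun h => (Finset.mem_erase.1 hz).1 (Prod.ext h.1 h.2)
    simp only [f]
    rw [norm_mul, norm_mul, AddChar.norm_apply, one_mul]
    exact (mul_le_of_le_one_left (norm_nonneg _) (norm_mulChar_apply_le_one _ _)).trans
      (norm_kloostermanSum_le h2 hc hz')
  rw [← Finset.add_sum_erase _ _ (Finset.mem_univ ((1, 1) : AddChar k ℂ × MulChar k ℂ)), hone,
    add_eq_zero_iff_eq_neg] at hzero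
  have hle := norm_sum_le_of_le _ hrest
  rw [← norm_neg, ← hzero, Finset.sum_const, Finset.card_erase_of_mem (Finset.mem_univ _),
    Finset.card_univ, card_addChar_prod_mulChar, nsmul_eq_mul, Nat.cast_pred] at hle
  · have := (Complex.re_le_norm _).trans hle
    simp only [Complex.sub_re, Complex.natCast_re, Complex.one_re] at this
    linarith
  · have := Fintype.one_lt_card (α := k)
    exact Nat.mul_pos (by lia) (by lia)

theorem two_mul_sub_one_mul_sqrt_lt {q n : ℕ} (hq : 3 ≤ q) (hn : 4 < n) :
    2 * ((q * (q - 1) : ℕ) - 1 : ℝ) * √((q ^ n : ℕ) : ℝ) < ((q ^ n : ℕ) : ℝ) - 1 := by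
  obtain ⟨a, rfl⟩ : ∃ a, q = a + 3 := ⟨q - 3, by lia⟩
  set x := √(((a + 3) ^ n : ℕ) : ℝ) with hx
  have hxx : x ^ 2 = (((a + 3) ^ n : ℕ) : ℝ) := Real.sq_sqrt (Nat.cast_nonneg _)
  set d : ℝ := (((a + 3) * (a + 3 - 1) : ℕ) : ℝ) with hd
  have hd' : d = ((a : ℝ) + 3) * (a + 2) := by
    rw [hd, show a + 3 - 1 = a + 2 by lia]
    push_cast
    rfl
  have hpow : (a + 3 : ℝ) ^ 5 ≤ x ^ 2 := by
    rw [hxx]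
    exact_mod_cast Nat.pow_le_pow_right (by lia) hn
  have hdx : 2 * d - 1 ≤ x := by
    refine le_of_sq_le_sq (le_trans ?_ hpow) (Real.sqrt_nonneg _)
    rw [hd', ← sub_nonneg]
    ring_nf
    positivity
  have hd6 : 6 ≤ d := by
    rw [hd']
    nlinarith [Nat.cast_nonneg (α := ℝ) a]
  rw [← hxx]
  nlinarith

theorem exists_finiteField_algebra {p m n : ℕ} [Fact p.Prime] (hm : 0 < m)
    {F : Type*} [Field F] [Fintype F] (hF : Fintype.card F = (p ^ m) ^ n) :
    ∃ (k : Type) (_ : Field k) (_ : Fintype k) (_ : Algebra k F),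
      Fintype.card k = p ^ m ∧ Module.finrank k F = n := by
  have hp : 1 < p := (Fact.out : p.Prime).one_lt
  have : CharP F p := by
    refine charP_of_card_eq_prime_pow (f := m * n) ?_
    rw [hF, pow_mul]
  let _ : Algebra (ZMod p) F := ZMod.algebra F p
  let k := GaloisField p m
  let _ : Fintype k := Fintype.ofFinite k
  have hk : Fintype.card k = p ^ m := by
    rw [← Nat.card_eq_fintype_card, GaloisField.card p m hm.ne']
  have hrank : Module.finrank (ZMod p) F = m * n := by
    apply Nat.pow_right_injective hp
    simp only
    rw [pow_mul, ← hF, Module.card_eq_pow_finrank (K := ZMod p) (V := F), ZMod.card]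
  obtain ⟨f⟩ := FiniteField.nonempty_algHom_of_finrank_dvd (F := ZMod p) (K := k) (L := F)
    (by rw [GaloisField.finrank p hm.ne', hrank]; exact dvd_mul_right m n)
  let _ : Algebra k F := f.toRingHom.toAlgebra
  refine ⟨k, inferInstance, inferInstance, inferInstance, hk, ?_⟩
  apply Nat.pow_right_injective (Nat.one_lt_pow hm.ne' hp)
  simp only
  rw [← hF, Module.card_eq_pow_finrank (K := k) (V := F), hk]

end Existence

/-- for `q ≥ 3` a power of an odd prime, `c ∈ F_q*` and `k > 4`, for
every `υ ∈ F_q` and `ω ∈ F_q*` there exists `ξ ∈ F_{q^k}*` with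
`Tr(ξ + c·ξ⁻¹) + υ = 0` and `ω·N(ξ) = 1`. -/
theorem exists_element_with_trace_and_norm
    (p m k : ℕ) (hp : p.Prime) (hodd : Odd p) (hm : 0 < m) (hk : 4 < k)
    (q : ℕ) (hq : q = p ^ m) (hq3 : 3 ≤ q)
    (F : Type*) [Field F] [Fintype F] (hF : Fintype.card F = q ^ k)
    (c : F) (hc : c ≠ 0) (hcq : c ^ q = c)
    (Tr : F → F) (hTr : ∀ x, Tr x = ∑ i ∈ Finset.range k, x ^ q ^ i)
    (N : F → F) (hN : ∀ x, N x = x ^ ((q ^ k - 1) / (q - 1))) :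
    ∀ υ ω : F, υ ^ q = υ → ω ≠ 0 → ω ^ q = ω →
      ∃ ξ : F, ξ ≠ 0 ∧ Tr (ξ + c * ξ⁻¹) + υ = 0 ∧ ω * N ξ = 1 := by
  intro υ ω hυ hω hωq
  have : Fact p.Prime := ⟨hp⟩
  obtain ⟨K, _, _, _, hK, hrank⟩ := exists_finiteField_algebra hm (hq ▸ hF)
  rw [← hq] at hK
  have hKF : Fintype.card F = Fintype.card K ^ k := by rw [hF, hK]
  rw [← hK] at hcq hυ hωq
  obtain ⟨c, rfl⟩ := exists_algebraMap_eq_of_pow_card_eq hcq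
  obtain ⟨υ, rfl⟩ := exists_algebraMap_eq_of_pow_card_eq hυ
  obtain ⟨ω, rfl⟩ := exists_algebraMap_eq_of_pow_card_eq hωq
  have hω' : ω ≠ 0 := (map_ne_zero _).1 hω
  have h2 : (2 : K) ≠ 0 := by
    refine Ring.two_ne_zero (FiniteField.even_card_iff_char_two.not.2 ?_)
    rw [hK, hq, Nat.odd_iff.1 hodd.pow]
    exact one_ne_zero
  obtain ⟨ξ, htr, hnorm⟩ := exists_trace_eq_and_norm_eq (F := F) h2 ((map_ne_zero _).1 hc) (-υ)
    (inv_ne_zero hω') (by rw [hKF]; exact two_mul_sub_one_mul_sqrt_lt (hK ▸ hq3) hk)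
  have htr' := congrArg (algebraMap K F) htr
  have hnorm' := congrArg (algebraMap K F) hnorm
  rw [FiniteField.algebraMap_trace_eq_sum_pow, hrank, Nat.card_eq_fintype_card, hK, ← hTr] at htr'
  rw [FiniteField.algebraMap_norm_eq_pow, Nat.card_eq_fintype_card, Nat.card_eq_fintype_card, hF,
    hK, ← hN] at hnorm'
  refine ⟨ξ, ?_, ?_, ?_⟩
  · rintro rfl
    rw [Algebra.norm_zero] at hnorm
    exact inv_ne_zero hω' hnorm.symm
  · rw [htr', map_neg, neg_add_cancel]
  · rw [hnorm', map_inv₀, mul_inv_cancel₀ hω]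
end

section
/- Let p be an odd prime, q a power of p, n > 4, a ∈ F_{q^n}*, and let ℓ : F_{q^n} → F_{q^n} be an F_p-linear map. If a = α^{(q+1)/2} for some α ∈ F_{q^n}*, or if n is odd, then the function f(x) = Tr(a·x^{q+1}) + ℓ(x²) is not a planar function on F_{q^n}. -/
/-- A base-`q` expansion `g` of `t * q ^ n - s` with integer digits comes from carries. -/
theorem exists_carry (q : ℤ) (g : ℕ → ℤ) (n : ℕ) (s t : ℤ)
    (h : s + ∑ i ∈ Finset.range n, g i * q ^ i = t * q ^ n) :
    ∃ c : ℕ → ℤ, c 0 = s ∧ c n = t ∧ ∀ i < n, c i + g i = q * c (i + 1) := by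
  induction n generalizing t with
  | zero => exact ⟨fun _ => s, rfl, by simpa using h, by simp⟩
  | succ n ih =>
    rw [Finset.sum_range_succ] at h
    obtain ⟨c, h0, hn, hc⟩ := ih (q * t - g n) (by rw [pow_succ] at h; linear_combination h)
    refine ⟨Function.update c (n + 1) t, by simp [h0], by simp, fun i hi => ?_⟩
    rw [Function.update_of_ne (by omega)]
    rcases Nat.lt_succ_iff_lt_or_eq.1 hi with hi | rfl
    · rw [Function.update_of_ne (by omega), hc i hi]
    · rw [Function.update_self, hn]; ring

theorem sub_abs_le_abs_add_mul_sub_abs {h k c : ℤ} (hk : |k| ≤ h) :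
    |k| ≤ |k + (2 * h + 1) * c| - |c| := by
  rcases eq_or_ne c 0 with rfl | hc
  · simp
  · have h1 : 1 ≤ |c| := Int.one_le_abs hc
    have h2 := abs_sub_abs_le_abs_sub ((2 * h + 1) * c) (-k)
    rw [abs_mul, abs_neg, abs_of_nonneg (by linarith [abs_nonneg k] : (0 : ℤ) ≤ 2 * h + 1),
      sub_neg_eq_add, add_comm ((2 * h + 1) * c)] at h2
    nlinarith [abs_nonneg k]

theorem half_sub_abs_le {h k c : ℤ} (hk : |k| ≤ h) :
    h - |k| ≤ |h + k + (2 * h + 1) * c| - |c| := by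
  have hh : 0 ≤ h := (abs_nonneg k).trans hk
  have hk' := abs_le.1 hk
  have hk1 := neg_abs_le k
  have hk2 := le_abs_self k
  rcases lt_or_ge c 0 with hc | hc
  · rw [abs_of_neg hc]
    have := neg_le_abs (h + k + (2 * h + 1) * c)
    nlinarith
  · rw [abs_of_nonneg hc]
    have := le_abs_self (h + k + (2 * h + 1) * c)
    nlinarith

theorem eq_zero_of_abs_add_abs_add_abs_le {h u v : ℤ} (hh : 0 < h)
    (H : |h + (2 * h + 1) * u| + |h + (2 * h + 1) * v - u| + |v| ≤ 2 * h) :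
    u = 0 ∧ v = 0 := by
  have g0 := abs_nonneg (h + (2 * h + 1) * u)
  have g1 := abs_nonneg (h + (2 * h + 1) * v - u)
  have g2 := abs_nonneg v
  have l0 := abs_le.1 (by linarith : |h + (2 * h + 1) * u| ≤ 2 * h)
  have l1 := abs_le.1 (by linarith : |h + (2 * h + 1) * v - u| ≤ 2 * h)
  have hu1 : u < 1 := by by_contra! hcon; nlinarith
  have hu2 : -2 < u := by by_contra! hcon; nlinarith
  have hv1 : v < 1 := by by_contra! hcon; nlinarith
  have hv2 : -2 < v := by by_contra! hcon; nlinarith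
  clear l0 l1 g0 g1 g2
  have hu : u = 0 ∨ u = -1 := by omega
  have hv : v = 0 ∨ v = -1 := by omega
  rcases hu with rfl | rfl <;> rcases hv with rfl | rfl
  · simp
  all_goals exfalso; simp only [abs, max_def] at H; split_ifs at H <;> linarith

/-- With `q = 2 * h + 1`, the exponent `h * (1 + q)` modulo `(q ^ n - 1) / (q - 1)`, `n = r + 2`,
has a unique signed base-`q` expansion whose digits have absolute values adding up to at most
`q - 1`. -/
theorem eq_of_sum_abs_le_of_dvd {h : ℤ} (hh : 0 < h) (r : ℕ) (hr : 2 < r) (f : ℕ → ℤ)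
    (hf : ∑ i ∈ Finset.range (r + 2), |f i| ≤ 2 * h)
    (hd : (2 * h + 1) ^ (r + 2) - 1 ∣
      2 * h * (∑ i ∈ Finset.range (r + 2), f i * (2 * h + 1) ^ i - h * (1 + (2 * h + 1)))) :
    f 0 = h ∧ f 1 = h ∧ ∀ i < r, f (i + 2) = 0 := by
  obtain ⟨t, ht⟩ := hd
  obtain ⟨k, s, hts, hk⟩ : ∃ k s : ℤ, t = k + 2 * h * s ∧ |k| ≤ h := by
    refine ⟨(t + h) % (2 * h) - h, (t + h) / (2 * h), ?_, abs_le.2 ?_⟩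
    · linarith [Int.emod_add_mul_ediv (t + h) (2 * h)]
    · have := Int.emod_nonneg (t + h) (by omega : 2 * h ≠ 0)
      have := Int.emod_lt_of_pos (t + h) (by omega : 0 < 2 * h)
      omega
  set q : ℤ := 2 * h + 1 with hq
  let e : ℕ → ℤ := fun i => if i < 2 then h else 0
  have hgeom : (∑ i ∈ Finset.range (r + 2), q ^ i) * (2 * h) = q ^ (r + 2) - 1 := by
    have := geom_sum_mul q (r + 2)
    rwa [show q - 1 = 2 * h by rw [hq]; ring] at this
  have he : ∑ i ∈ Finset.range (r + 2), e i * q ^ i = h * (1 + q) := by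
    rw [Finset.sum_range_succ', Finset.sum_range_succ']
    simp [e]; ring
  obtain ⟨c, hc0, hcn, hc⟩ := exists_carry q (fun i => f i - e i - k) (r + 2) s s (by
    simp only [sub_mul, Finset.sum_sub_distrib, he, ← Finset.mul_sum]
    refine mul_left_cancel₀ (by omega : 2 * h ≠ 0) ?_
    rw [hts, ← hgeom] at ht
    linear_combination ht + 2 * h * s * hgeom)
  have hfc : ∀ i < r + 2, f i = e i + k + q * c (i + 1) - c i := fun i hi => by
    linarith [hc i hi]
  have hshift : ∑ i ∈ Finset.range (r + 2), |c i| = ∑ i ∈ Finset.range (r + 2), |c (i + 1)| := by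
    have h1 := Finset.sum_range_succ (fun i => |c i|) (r + 2)
    have h2 := Finset.sum_range_succ' (fun i => |c i|) (r + 2)
    rw [hcn] at h1; rw [hc0] at h2
    linarith
  have hle : ∑ i ∈ Finset.range (r + 2), (|e i + k + q * c (i + 1)| - |c (i + 1)|) ≤ 2 * h := by
    rw [Finset.sum_sub_distrib, ← hshift, ← Finset.sum_sub_distrib]
    refine le_trans (Finset.sum_le_sum fun i hi => ?_) hf
    rw [hfc i (Finset.mem_range.1 hi)]
    exact abs_sub_abs_le_abs_sub _ _
  rw [Finset.sum_range_succ', Finset.sum_range_succ'] at hle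
  have e0 : e 0 = h := rfl
  have e1 : e (0 + 1) = h := rfl
  have e2 : ∀ i, e (i + 1 + 1) = 0 := fun i => by simp [e]
  simp only [e0, e1, e2, zero_add] at hle
  have b0 := half_sub_abs_le (c := c 1) hk
  have b1 := half_sub_abs_le (c := c (1 + 1)) hk
  have hk0 : k = 0 := by
    have b2 : ∑ i ∈ Finset.range r, |k| ≤
        ∑ i ∈ Finset.range r, (|k + q * c (i + 1 + 1 + 1)| - |c (i + 1 + 1 + 1)|) :=
      Finset.sum_le_sum fun i _ => sub_abs_le_abs_add_mul_sub_abs hk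
    rw [Finset.sum_const, Finset.card_range, nsmul_eq_mul] at b2
    have hr' : (3 : ℤ) ≤ r := by exact_mod_cast hr
    have := abs_nonneg k
    exact abs_eq_zero.1 (by nlinarith)
  subst hk0
  simp only [abs_zero, sub_zero, zero_add, add_zero] at *
  have hq0 : 0 < q := by omega
  have hnn : ∀ i ∈ Finset.range r, 0 ≤ |q * c (i + 1 + 1 + 1)| - |c (i + 1 + 1 + 1)| := by
    intro i _
    rw [abs_mul, abs_of_pos hq0]
    nlinarith [abs_nonneg (c (i + 1 + 1 + 1))]
  have hz := (Finset.sum_eq_zero_iff_of_nonneg hnn).1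
    (le_antisymm (by linarith) (Finset.sum_nonneg hnn))
  have hc3 : ∀ i < r, c (i + 3) = 0 := by
    intro i hi
    have := hz i (Finset.mem_range.2 hi)
    rw [abs_mul, abs_of_pos hq0, hq] at this
    exact abs_eq_zero.1 (by
      have h3 : 2 * h * |c (i + 3)| = 0 := by linarith
      simpa [hh.ne'] using h3)
  have hs : c 0 = 0 := by
    obtain ⟨j, rfl⟩ : ∃ j, r = j + 1 := ⟨r - 1, by omega⟩
    rw [hc0, ← hcn]; exact hc3 j (by omega)
  obtain ⟨j, rfl⟩ : ∃ j, r = j + 1 := ⟨r - 1, by omega⟩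
  rw [Finset.sum_range_succ', Finset.sum_range_succ', Finset.sum_range_succ'] at hf
  have hnn' := Finset.sum_nonneg fun i (_ : i ∈ Finset.range j) => abs_nonneg (f (i + 1 + 1 + 1))
  have f0 := hfc 0 (by omega)
  have f1 := hfc 1 (by omega)
  have f2 := hfc 2 (by omega)
  have hf' : |f 0| + |f 1| + |f 2| ≤ 2 * h := by
    simp only [zero_add] at hf; norm_num at hf; linarith
  simp only [e0, show e 1 = h from rfl, show e 2 = 0 from rfl, hs, hc3 0 (by omega)] at f0 f1 f2
  have hcc : c 1 = 0 ∧ c 2 = 0 := eq_zero_of_abs_add_abs_add_abs_le hh (by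
    rw [f0, f1, f2] at hf'
    simpa [hq] using hf')
  refine ⟨by simp [f0, hcc], by simp [f1, hcc], fun i hi => ?_⟩
  rw [hfc _ (by omega), e2, hc3 i hi]
  rcases i with _ | i
  · simp [hcc]
  · simp [hc3 i (by omega)]

theorem sum_units_zpow {K : Type*} [Field K] [Fintype K] [DecidableEq K] (j : ℤ) :
    ∑ x : Kˣ, (x : K) ^ j = if ((Fintype.card K - 1 : ℕ) : ℤ) ∣ j then -1 else 0 := by
  have hpos : (0 : ℤ) < ((Fintype.card K - 1 : ℕ) : ℤ) := by
    have := Fintype.one_lt_card (α := K); omega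
  obtain ⟨i, hi⟩ := Int.eq_ofNat_of_zero_le (Int.emod_nonneg j hpos.ne')
  have hj : j = i + ((Fintype.card K - 1 : ℕ) : ℤ) * (j / ((Fintype.card K - 1 : ℕ) : ℤ)) := by
    rw [← hi]; exact (Int.emod_add_mul_ediv _ _).symm
  have key : ∀ x : Kˣ, (x : K) ^ j = (x : K) ^ i := fun x => by
    rw [hj, zpow_add₀ x.ne_zero, zpow_mul, zpow_natCast, zpow_natCast,
      FiniteField.pow_card_sub_one_eq_one _ x.ne_zero, one_zpow, mul_one]
  have hdvd : ((Fintype.card K - 1 : ℕ) : ℤ) ∣ j ↔ Fintype.card K - 1 ∣ i := by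
    rw [hj, dvd_add_left (dvd_mul_right _ _), Int.natCast_dvd_natCast]
  simp only [key, FiniteField.sum_pow_units, hdvd]

/-- If a power of a Laurent polynomial equals `1` on `Kˣ`, then a nontrivial exponent reached
in a unique way in its multinomial expansion has coefficient zero. -/
theorem coeff_eq_zero_of_pow_eq_one {K ι : Type*} [Field K] [Fintype K]
    [Fintype ι] [DecidableEq ι] (w : ι → ℤ) (C : ι → K) (M : ℕ) (E : ℤ) (k₀ : ι → ℕ)
    (hk₀ : ∑ i, k₀ i = M) (hE₀ : ∑ i, k₀ i * w i = E)
    (hE : ¬((Fintype.card K - 1 : ℕ) : ℤ) ∣ E)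
    (huniq : ∀ k : ι → ℕ, ∑ i, k i = M →
      ((Fintype.card K - 1 : ℕ) : ℤ) ∣ ∑ i, k i * w i - E → k = k₀)
    (H : ∀ x : Kˣ, (∑ i, C i * (x : K) ^ w i) ^ M = 1) :
    (Nat.multinomial Finset.univ k₀ : K) * ∏ i, C i ^ k₀ i = 0 := by
  classical
  have h0 : ∑ x : Kˣ, (∑ i, C i * (x : K) ^ w i) ^ M * (x : K) ^ (-E) = 0 := by
    simp only [H, one_mul, sum_units_zpow, dvd_neg, if_neg hE]
  simp only [Finset.sum_pow_eq_sum_piAntidiag, Finset.sum_mul] at h0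
  rw [Finset.sum_comm] at h0
  have hterm : ∀ k : ι → ℕ, ∑ x : Kˣ, (Nat.multinomial Finset.univ k : K) *
      (∏ i, (C i * (x : K) ^ w i) ^ k i) * (x : K) ^ (-E) =
      (Nat.multinomial Finset.univ k : K) * (∏ i, C i ^ k i) *
        if ((Fintype.card K - 1 : ℕ) : ℤ) ∣ ∑ i, k i * w i - E then -1 else 0 := fun k => by
    rw [← sum_units_zpow, Finset.mul_sum]
    refine Finset.sum_congr rfl fun x _ => ?_
    have hx : ∏ i, ((x : K) ^ w i) ^ k i = (x : K) ^ ∑ i, k i * w i := by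
      induction (Finset.univ : Finset ι) using Finset.induction_on with
      | empty => simp
      | insert i s hi ih =>
        rw [Finset.prod_insert hi, Finset.sum_insert hi, zpow_add₀ x.ne_zero, ih, mul_comm (k i : ℤ),
          zpow_mul, zpow_natCast]
    simp only [mul_pow]
    rw [Finset.prod_mul_distrib, hx, sub_eq_add_neg, zpow_add₀ x.ne_zero]
    ring
  simp only [hterm] at h0
  rw [Finset.sum_eq_single k₀ ?_ ?_] at h0
  · simpa [hE₀] using h0
  · intro k hk hne
    rw [if_neg fun hd => hne (huniq k (Finset.mem_piAntidiag.1 hk).1 hd), mul_zero]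
  · intro hk
    exact absurd (Finset.mem_piAntidiag.2 ⟨hk₀, by simp⟩) hk

theorem cast_choose_prime_pow_sub_one {R : Type*} [CommRing R] (p m k : ℕ) [CharP R p]
    (hp : p.Prime) (hk : k < p ^ m) : ((p ^ m - 1).choose k : R) = (-1) ^ k := by
  induction k with
  | zero => simp
  | succ k ih =>
    have hc : (((p ^ m).choose (k + 1) : ℕ) : R) = 0 :=
      (CharP.cast_eq_zero_iff R p _).2 (hp.dvd_choose_pow k.succ_ne_zero hk.ne)
    rw [← Nat.sub_add_cancel (by omega : 1 ≤ p ^ m), Nat.choose_succ_succ, Nat.cast_add,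
      ih (by omega)] at hc
    rw [pow_succ]; linear_combination hc

theorem cast_multinomial_ne_zero {R ι : Type*} [CommRing R] [Nontrivial R] [Fintype ι]
    (p m h : ℕ) [CharP R p] (hp : p.Prime) (hq : p ^ m = 2 * h + 1) (k : ι → ℕ)
    (hsum : ∑ i, k i = 2 * h) (hprod : ∏ i, (k i).factorial = h.factorial * h.factorial) :
    (Nat.multinomial Finset.univ k : R) ≠ 0 := by
  have h1 := Nat.multinomial_spec Finset.univ k
  rw [hsum, hprod] at h1
  have h2 := Nat.choose_mul_factorial_mul_factorial (by omega : h ≤ 2 * h)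
  rw [show 2 * h - h = h by omega, ← h1, mul_assoc, mul_comm] at h2
  rw [← Nat.eq_of_mul_eq_mul_left (by positivity) h2,
    show 2 * h = p ^ m - 1 by omega, cast_choose_prime_pow_sub_one p m h hp (by omega)]
  rcases neg_one_pow_eq_or R h with h | h <;> simp [h]

theorem eq_half_of_sum_eq_of_dvd {h : ℕ} (hh : 0 < h) (r : ℕ) (hr : 2 < r)
    (k₀ : ℕ) (k l : Fin (r + 2) → ℕ) (hk : k₀ + (∑ i, k i + ∑ i, l i) = 2 * h)
    (hd : (2 * h + 1 : ℤ) ^ (r + 2) - 1 ∣ 2 * h *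
      (∑ i, ((k i : ℤ) - l i) * (2 * h + 1) ^ (i : ℕ) - h * (1 + (2 * h + 1)))) :
    k₀ = 0 ∧ (k = fun i : Fin (r + 2) => if (i : ℕ) < 2 then h else 0) ∧ l = 0 := by
  let f : ℕ → ℤ := fun i => if hi : i < r + 2 then (k ⟨i, hi⟩ : ℤ) - l ⟨i, hi⟩ else 0
  have hf : ∀ i : Fin (r + 2), f i = (k i : ℤ) - l i := fun i => by simp [f]
  obtain ⟨f0, f1, f2⟩ := eq_of_sum_abs_le_of_dvd (h := h) (by exact_mod_cast hh) r hr f (by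
    rw [Finset.sum_range]
    have : ∑ i : Fin (r + 2), |f i| ≤ ∑ i, ((k i : ℤ) + l i) :=
      Finset.sum_le_sum fun i _ => by rw [hf, abs_le]; constructor <;> omega
    rw [Finset.sum_add_distrib] at this
    have hk' : (k₀ : ℤ) + (∑ i, (k i : ℤ) + ∑ i, (l i : ℤ)) = 2 * h := by exact_mod_cast hk
    omega) (by simpa only [Finset.sum_range, hf] using hd)
  have hf' : ∀ i : Fin (r + 2), f i = if (i : ℕ) < 2 then (h : ℤ) else 0 := by
    rintro ⟨i, hi⟩
    rcases i with _ | _ | i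
    · simpa using f0
    · simpa using f1
    · simpa using f2 i (by omega)
  have hkl : ∑ i, (k i : ℤ) - ∑ i, (l i : ℤ) = 2 * h := by
    rw [← Finset.sum_sub_distrib]
    simp only [← hf, hf']
    rw [Fin.sum_univ_succ, Fin.sum_univ_succ]
    simp; ring
  have hl : ∑ i, l i = 0 := by
    have hk' : (k₀ : ℤ) + (∑ i, (k i : ℤ) + ∑ i, (l i : ℤ)) = 2 * h := by exact_mod_cast hk
    have : 0 ≤ ∑ i, (l i : ℤ) := Finset.sum_nonneg fun i _ => by positivity
    have : ∑ i, (l i : ℤ) = 0 := by omega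
    exact_mod_cast this
  have hk0 : k₀ = 0 := by
    have : ((∑ i, l i : ℕ) : ℤ) = 0 := by exact_mod_cast hl
    push_cast at this
    have hk' : (k₀ : ℤ) + (∑ i, (k i : ℤ) + ∑ i, (l i : ℤ)) = 2 * h := by exact_mod_cast hk
    omega
  have hl' : l = 0 := funext fun i => by simpa using Finset.sum_eq_zero_iff.1 hl i (Finset.mem_univ i)
  refine ⟨hk0, funext fun i => ?_, hl'⟩
  have := (hf i).symm.trans (hf' i)
  simp only [hl', Pi.zero_apply, Nat.cast_zero, sub_zero] at this
  split_ifs at this ⊢ <;> exact_mod_cast this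

theorem sum_range_pow_pow_succ {R : Type*} [CommRing R] (y : R) (q n : ℕ) (hy : y ^ q ^ n = y) :
    ∑ i ∈ Finset.range n, (y ^ q ^ i) ^ q = ∑ i ∈ Finset.range n, y ^ q ^ i := by
  have h1 := Finset.sum_range_succ (fun i => y ^ q ^ i) n
  rw [Finset.sum_range_succ', hy, pow_zero, pow_one] at h1
  simpa only [← pow_mul, ← pow_succ] using add_right_cancel h1

theorem exists_unit_trace_add_eq_zero {K : Type*} [Field K] [Fintype K] (p m n : ℕ)
    (hp : p.Prime) (hodd : Odd p) (hm : 0 < m) (hn : 4 < n) [CharP K p]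
    (hK : Fintype.card K = (p ^ m) ^ n) {A : K} (hA : A ≠ 0) (B C : K) (hC : C ^ p ^ m = C) :
    ∃ x : Kˣ, ∑ i ∈ Finset.range n, (A * (x : K) ^ ((p ^ m : ℤ) - 1) +
      B * (x : K) ^ (-((p ^ m : ℤ) - 1))) ^ (p ^ m) ^ i + C = 0 := by
  by_contra! hne
  obtain ⟨h, hq⟩ := hodd.pow (n := m)
  have hq1 : 1 < p ^ m := Nat.one_lt_pow hm.ne' hp.one_lt
  have hh : 0 < h := by omega
  obtain ⟨r, rfl⟩ : ∃ r, n = r + 2 := ⟨n - 2, by omega⟩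
  have hr : 2 < r := by omega
  have : Fact p.Prime := ⟨hp⟩
  have hfrob : ∀ (i : ℕ) (x y : K), (x + y) ^ (p ^ m) ^ i = x ^ (p ^ m) ^ i + y ^ (p ^ m) ^ i := by
    intro i x y
    rw [← pow_mul, add_pow_char_pow]
  have hqz : (p ^ m : ℤ) = 2 * h + 1 := by exact_mod_cast hq
  rw [hqz] at hne
  have hcard : ((Fintype.card K - 1 : ℕ) : ℤ) = (2 * h + 1 : ℤ) ^ (r + 2) - 1 := by
    rw [Nat.cast_sub Fintype.card_pos, hK, hq]; push_cast; ring
  let w : Option (Fin (r + 2) ⊕ Fin (r + 2)) → ℤ := fun o => o.elim 0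
    (Sum.elim (fun i => 2 * h * (2 * h + 1) ^ (i : ℕ)) fun i => -(2 * h * (2 * h + 1) ^ (i : ℕ)))
  let D : Option (Fin (r + 2) ⊕ Fin (r + 2)) → K := fun o => o.elim C
    (Sum.elim (fun i => A ^ (p ^ m) ^ (i : ℕ)) fun i => B ^ (p ^ m) ^ (i : ℕ))
  let k₀ : Option (Fin (r + 2) ⊕ Fin (r + 2)) → ℕ := fun o => o.elim 0
    (Sum.elim (fun i => if (i : ℕ) < 2 then h else 0) fun _ => 0)
  have hsum : ∑ i, k₀ i = 2 * h := by
    rw [Fintype.sum_option, Fintype.sum_sum_type, Fin.sum_univ_succ, Fin.sum_univ_succ]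
    simp [k₀]; omega
  have hzero : ∀ x : Kˣ, (∑ i, D i * (x : K) ^ w i) ^ (2 * h) = 1 := by
    intro x
    set S := ∑ i, D i * (x : K) ^ w i with hS
    have hexp : S = ∑ i ∈ Finset.range (r + 2), (A * (x : K) ^ ((2 * h + 1 : ℤ) - 1) +
        B * (x : K) ^ (-((2 * h + 1 : ℤ) - 1))) ^ (p ^ m) ^ i + C := by
      rw [hS, Fintype.sum_option, Fintype.sum_sum_type, Finset.sum_range, add_comm,
        ← Finset.sum_add_distrib]
      simp only [D, w, Option.elim, Sum.elim_inl, Sum.elim_inr, zpow_zero, mul_one,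
        add_sub_cancel_right]
      congr 1
      refine Finset.sum_congr rfl fun i _ => ?_
      rw [hfrob, mul_pow, mul_pow, ← zpow_natCast (_ ^ (2 * h : ℤ)), ← zpow_mul,
        ← zpow_natCast (_ ^ (-(2 * h : ℤ))), ← zpow_mul, neg_mul, hq]
      push_cast
      rfl
    have hS0 : S ≠ 0 := by rw [hexp]; exact hne x
    have hSq : S ^ p ^ m = S := by
      rw [hexp, add_pow_char_pow, hC, sum_pow_char_pow, sum_range_pow_pow_succ]
      rw [← hK, FiniteField.pow_card]
    rw [hq, pow_succ] at hSq
    exact mul_right_cancel₀ hS0 (by rw [hSq, one_mul])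
  have hE₀ : ∑ i, k₀ i * w i = 2 * h * (h * (1 + (2 * h + 1))) := by
    rw [Fintype.sum_option, Fintype.sum_sum_type, Fin.sum_univ_succ, Fin.sum_univ_succ]
    simp [k₀, w]; ring
  have huniq : ∀ k : Option (Fin (r + 2) ⊕ Fin (r + 2)) → ℕ, ∑ i, k i = 2 * h →
      ((Fintype.card K - 1 : ℕ) : ℤ) ∣ ∑ i, k i * w i - 2 * h * (h * (1 + (2 * h + 1))) →
      k = k₀ := by
    intro k hk hd
    rw [Fintype.sum_option, Fintype.sum_sum_type] at hk
    obtain ⟨h1, h2, h3⟩ := eq_half_of_sum_eq_of_dvd hh r hr _ _ _ hk (by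
      rw [← hcard]
      convert hd using 1
      rw [Fintype.sum_option, Fintype.sum_sum_type, mul_sub, ← Finset.sum_add_distrib,
        Finset.mul_sum]
      simp only [w, Option.elim, Sum.elim_inl, Sum.elim_inr, mul_zero, zero_add]
      congr 1
      exact Finset.sum_congr rfl fun i _ => by ring)
    funext o
    rcases o with _ | i | i
    · exact h1
    · exact congrFun h2 i
    · exact congrFun h3 i
  have hE : ¬((Fintype.card K - 1 : ℕ) : ℤ) ∣ 2 * h * (h * (1 + (2 * h + 1))) := by
    intro hd
    have := congrFun (huniq (fun o => o.elim (2 * h) fun _ => 0)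
      (by simp [Fintype.sum_option]) (by
        simp only [Fintype.sum_option, w, Option.elim]
        simpa using hd)) none
    simp only [k₀, Option.elim] at this
    omega
  rcases mul_eq_zero.1 (coeff_eq_zero_of_pow_eq_one w D (2 * h) _ k₀ hsum hE₀ hE huniq hzero)
    with h0 | h0
  · refine cast_multinomial_ne_zero p m h hp hq k₀ hsum ?_ h0
    rw [Fintype.prod_option, Fintype.prod_sum_type, Fin.prod_univ_succ, Fin.prod_univ_succ]
    simp [k₀]
  · obtain ⟨o, -, ho⟩ := Finset.prod_eq_zero_iff.1 h0
    rcases o with _ | i | i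
    · simp [k₀] at ho
    · exact pow_ne_zero _ (pow_ne_zero _ hA) ho
    · simp [k₀] at ho

/-- for `n > 4`, if `a = α^{(q+1)/2}` for some `α ∈ F_{q^n}*` or `n` is
odd, then `Tr(a·x^{q+1}) + ℓ(x²)` is not planar on `F_{q^n}`. -/
theorem not_planar_of_higher_degree
    (p m n : ℕ) (hp : p.Prime) (hodd : Odd p) (hm : 0 < m) (hn : 4 < n)
    (q : ℕ) (hq : q = p ^ m)
    (F : Type*) [Field F] [Fintype F] (hF : Fintype.card F = q ^ n)
    (a : F) (ha : a ≠ 0)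
    (ℓ : F → F) (hℓ : ∀ x y, ℓ (x + y) = ℓ x + ℓ y)
    (Tr : F → F) (hTr : ∀ x, Tr x = ∑ i ∈ Finset.range n, x ^ q ^ i)
    (f : F → F) (hf : ∀ x, f x = Tr (a * x ^ (q + 1)) + ℓ (x ^ 2))
    (hcond : (∃ α : F, α ≠ 0 ∧ a = α ^ ((q + 1) / 2)) ∨ Odd n) :
    ¬∀ c : F, c ≠ 0 → Function.Bijective (fun x => f (x + c) - f x) := by
  subst hq
  have : Fact p.Prime := ⟨hp⟩
  obtain ⟨p', hchar, k, hp', hcard⟩ := FiniteField.card' F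
  have hpp : p = p' := by
    have : p ∣ p' ^ (k : ℕ) := by
      rw [← hcard, hF, ← pow_mul]
      exact dvd_pow_self p (by positivity)
    exact (Nat.prime_dvd_prime_iff_eq hp hp').1 (hp.dvd_of_dvd_pow this)
  subst hpp
  intro hplanar
  have hℓ0 : ℓ 0 = 0 := by simpa using hℓ 0 0
  have hTradd : ∀ x y, Tr (x + y) = Tr x + Tr y := fun x y => by
    simp only [hTr, ← pow_mul, add_pow_char_pow, Finset.sum_add_distrib]
  have hpolar : ∀ x y : F, x ≠ 0 → y ≠ 0 →
      Tr (a * (x ^ p ^ m * y + x * y ^ p ^ m)) + (ℓ (x * y) + ℓ (x * y)) ≠ 0 := by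
    intro x y hx hy h0
    refine hx ((hplanar y hy).1 (a₂ := 0) ?_)
    have hTr0 : Tr 0 = 0 := by simpa using hTradd 0 0
    have e1 : a * (x + y) ^ (p ^ m + 1) = a * x ^ (p ^ m + 1) + a * y ^ (p ^ m + 1) +
        a * (x ^ p ^ m * y + x * y ^ p ^ m) := by
      rw [pow_succ, add_pow_char_pow]; ring
    have e2 : (x + y) ^ 2 = x ^ 2 + y ^ 2 + (x * y + x * y) := by ring
    simp only [hf, e1, e2, hTradd, hℓ, zero_add, zero_pow (Nat.succ_ne_zero _), mul_zero, hTr0,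
      hℓ0]
    linear_combination h0
  obtain ⟨z, hz, hℓz⟩ : ∃ z : F, z ≠ 0 ∧ (ℓ z) ^ p ^ m = ℓ z := by
    by_cases hinj : Function.Injective ℓ
    · obtain ⟨z, hz⟩ := (Finite.injective_iff_surjective.1 hinj) 1
      exact ⟨z, fun h => by simp [h, hℓ0] at hz, by simp [hz]⟩
    · have : ¬∀ z, ℓ z = 0 → z = 0 := fun h =>
        hinj ((injective_iff_map_eq_zero (AddMonoidHom.mk' ℓ hℓ)).2 h)
      push Not at this
      obtain ⟨z, hz, hz0⟩ := this
      exact ⟨z, hz0, by rw [hz, zero_pow (pow_pos hp.pos m).ne']⟩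
  obtain ⟨x, hx⟩ := exists_unit_trace_add_eq_zero p m n hp hodd hm hn hF
    (mul_ne_zero ha hz) (a * z ^ p ^ m) (ℓ z + ℓ z) (by rw [add_pow_char_pow, hℓz])
  refine hpolar x (z * (x : F)⁻¹) x.ne_zero (mul_ne_zero hz (inv_ne_zero x.ne_zero)) ?_
  have hxz : (x : F) * (z * (x : F)⁻¹) = z := by field_simp
  rw [hxz, hTr, ← hx]
  congr 1
  refine Finset.sum_congr rfl fun i _ => ?_
  congr 1
  have hpz : (p ^ m : ℤ) = ((p ^ m : ℕ) : ℤ) := by push_cast; rfl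
  rw [zpow_neg, zpow_sub₀ x.ne_zero, zpow_one, hpz, zpow_natCast, mul_pow, inv_pow]
  have := x.ne_zero
  field_simp
end
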